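/- arXiv:math/0302026 — 5 statements merged into one kernel-verified Lean document; each statement's English description precedes it below -/
import Mathlib

section
/- Let G be a group admitting a finite presentation with g generators and r relations, let φ : G → ℤ be a surjective homomorphism with kernel H, and fix γ ∈ G with φ(γ) = 1. Equip the abelianization H^{ab} of H with the Λ-module structure in which t acts by the automorphism induced by conjugation x ↦ γ x γ⁻¹. Then this Λ-module admits a finite presentation with g − 1 generators and r relations; in particular its deficiency as a Λ-module is at least def(G) − 1. -/
open LaurentPolynomial

/-- `Λ = ℤ[t, t⁻¹]`, the ring of Laurent polynomials over `ℤ`. -/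
abbrev Λ : Type := LaurentPolynomial ℤ

/-- `GroupPres G g r` means that the group `G` admits a finite presentation with
`g` generators and `r` relations. -/
def GroupPres (G : Type) [Group G] (g r : ℕ) : Prop :=
  ∃ (π : FreeGroup (Fin g) →* G) (R : Finset (FreeGroup (Fin g))),
    Function.Surjective π ∧ R.card = r ∧
      Subgroup.normalClosure (R : Set (FreeGroup (Fin g))) = MonoidHom.ker π

/-- `ModPres M a b` means that the `Λ`-module `M` admits a finite presentation
with `a` generators and `b` relations: an exact sequence `Λ^b → Λ^a → M → 0`. -/
def ModPres (M : Type) [AddCommGroup M] [Module Λ M] (a b : ℕ) : Prop :=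
  ∃ (f : (Fin b → Λ) →ₗ[Λ] (Fin a → Λ)) (p : (Fin a → Λ) →ₗ[Λ] M),
    Function.Surjective p ∧ LinearMap.range f = LinearMap.ker p

/-- `D : G → A` is a crossed homomorphism, where `u : G` acts on the `Λ`-module `A` as
`t ^ ψ u`. -/
def IsCrossedHom {G A : Type*} [Group G] [AddCommGroup A] [Module Λ A]
    (ψ : G →* Multiplicative ℤ) (D : G → A) : Prop :=
  ∀ u v, D (u * v) = D u + (T (ψ u).toAdd : Λ) • D v

theorem T_smul_T_smul {A : Type*} [AddCommGroup A] [Module Λ A] (m n : ℤ) (a : A) :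
    (T m : Λ) • (T n : Λ) • a = (T (m + n) : Λ) • a := by
  rw [smul_smul, T_add]

namespace IsCrossedHom

variable {G A : Type*} [Group G] [AddCommGroup A] [Module Λ A]
  {ψ : G →* Multiplicative ℤ} {D : G → A}

theorem map_one (hD : IsCrossedHom ψ D) : D 1 = 0 := by
  simpa using hD 1 1

theorem map_inv (hD : IsCrossedHom ψ D) (u : G) :
    D u⁻¹ = -((T (ψ u⁻¹).toAdd : Λ) • D u) := by
  have h := hD u⁻¹ u
  rw [inv_mul_cancel, hD.map_one] at h
  exact eq_neg_of_add_eq_zero_left h.symm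

theorem map_conj (hD : IsCrossedHom ψ D) (u : G) {v : G} (hv : ψ v = 1) :
    D (u * v * u⁻¹) = (T (ψ u).toAdd : Λ) • D v := by
  rw [hD, hD, hD.map_inv]
  simp [hv, T_smul_T_smul]

theorem comp {F : Type*} [Group F] (hD : IsCrossedHom ψ D) (π : F →* G) :
    IsCrossedHom (ψ.comp π) (D ∘ π) := fun u v ↦ by
  simp [hD (π u) (π v)]

theorem map_linear {B : Type*} [AddCommGroup B] [Module Λ B] (hD : IsCrossedHom ψ D)
    (p : A →ₗ[Λ] B) : IsCrossedHom ψ (p ∘ D) := fun u v ↦ by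
  simp [hD u v]

/-- The zeros of a crossed homomorphism form a subgroup. -/
def zeros (hD : IsCrossedHom ψ D) : Subgroup G where
  carrier := {w | D w = 0}
  one_mem' := hD.map_one
  mul_mem' := fun {a b} (ha : D a = 0) (hb : D b = 0) ↦ by simp [hD a b, ha, hb]
  inv_mem' := fun {a} (ha : D a = 0) ↦ by simp [hD.map_inv, ha]

/-- The elements of `ker ψ` which a crossed homomorphism sends into a given submodule form a
subgroup. -/
def kerComap (hD : IsCrossedHom ψ D) (N : Submodule Λ A) : Subgroup G where
  carrier := {w | ψ w = 1 ∧ D w ∈ N}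
  one_mem' := ⟨ψ.map_one, by simp [hD.map_one]⟩
  mul_mem' := fun {a b} ha hb ↦ ⟨by simp [ha.1, hb.1], by
    rw [hD a b]
    exact N.add_mem ha.2 (N.smul_mem _ hb.2)⟩
  inv_mem' := fun {a} ha ↦ ⟨by simp [ha.1], by
    rw [hD.map_inv]
    exact N.neg_mem (N.smul_mem _ ha.2)⟩

instance (hD : IsCrossedHom ψ D) (N : Submodule Λ A) : (hD.kerComap N).Normal where
  conj_mem w hw u := ⟨by simp [hw.1], by
    rw [hD.map_conj u hw.1]
    exact N.smul_mem _ hw.2⟩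

theorem commutator_le_kerComap (hD : IsCrossedHom ψ D) :
    ⁅ψ.ker, ψ.ker⁆ ≤ hD.kerComap ⊥ := by
  rw [Subgroup.commutator_le]
  intro a ha b hb
  have ha : ψ a = 1 := ha
  have hb : ψ b = 1 := hb
  refine ⟨by simp [commutatorElement_def, ha, hb], ?_⟩
  rw [Submodule.mem_bot, commutatorElement_def, hD, hD.map_conj a hb, hD.map_inv]
  simp [ha, hb]

theorem ext_freeGroup {ι : Type*} {ψ : FreeGroup ι →* Multiplicative ℤ} {D E : FreeGroup ι → A}
    (hD : IsCrossedHom ψ D) (hE : IsCrossedHom ψ E)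
    (h : ∀ i, D (FreeGroup.of i) = E (FreeGroup.of i)) : D = E := by
  funext w
  induction w using FreeGroup.induction_on with
  | C1 => rw [hD.map_one, hE.map_one]
  | of i => exact h i
  | inv_of i ih => rw [hD.map_inv, hE.map_inv, ih]
  | mul x y hx hy => rw [hD, hE, hx, hy]

/-- A crossed homomorphism whose values span `A` and which kills some `z` with `ψ z = 1`
maps `ker ψ` onto `A`. -/
theorem exists_mem_ker_eq (hD : IsCrossedHom ψ D) {z : G} (hz : ψ z = Multiplicative.ofAdd 1)
    (hDz : D z = 0) (hspan : Submodule.span Λ (Set.range D) = ⊤) (a : A) :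
    ∃ w, ψ w = 1 ∧ D w = a := by
  have hzpow : ∀ n : ℤ, ψ (z ^ n) = Multiplicative.ofAdd n := fun n ↦ by
    rw [map_zpow, hz, ← ofAdd_zsmul]
    simp
  have hDzpow : ∀ n : ℤ, D (z ^ n) = 0 := fun n ↦ hD.zeros.zpow_mem hDz n
  let P : AddSubgroup A :=
    { carrier := {a | ∃ w, ψ w = 1 ∧ D w = a}
      zero_mem' := ⟨1, ψ.map_one, hD.map_one⟩
      add_mem' := by
        rintro _ _ ⟨u, hu, rfl⟩ ⟨v, hv, rfl⟩
        exact ⟨u * v, by simp [hu, hv], by simp [hD u v, hu]⟩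
      neg_mem' := by
        rintro _ ⟨u, hu, rfl⟩
        exact ⟨u⁻¹, by simp [hu], by simp [hD.map_inv, hu]⟩ }
  have hT : ∀ n : ℤ, ∀ a ∈ P, (T n : Λ) • a ∈ P := by
    rintro n _ ⟨u, hu, rfl⟩
    exact ⟨z ^ n * u * (z ^ n)⁻¹, by simp [hu], by simp [hD.map_conj _ hu, hzpow]⟩
  have hsmul : ∀ (c : Λ), ∀ a ∈ P, c • a ∈ P := by
    intro c a ha
    induction c using LaurentPolynomial.induction_on' with
    | add p q hp hq => rw [add_smul]; exact P.add_mem hp hq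
    | C_mul_T n m =>
      have : (C m * T n : Λ) • a = m • ((T n : Λ) • a) := by
        rw [mul_smul, eq_intCast C m, Int.cast_smul_eq_zsmul]
      rw [this]
      exact P.zsmul_mem (hT n a ha) m
  have ha : a ∈ Submodule.span Λ (Set.range D) := hspan ▸ Submodule.mem_top
  change a ∈ P
  induction ha using Submodule.span_induction with
  | mem x hx =>
    obtain ⟨u, rfl⟩ := hx
    refine ⟨u * z ^ (-(ψ u).toAdd), ?_, ?_⟩
    · rw [map_mul, hzpow]
      simp
    · rw [hD u, hDzpow, smul_zero, add_zero]
  | zero => exact P.zero_mem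
  | add x y _ _ hx hy => exact P.add_mem hx hy
  | smul c x _ hx => exact hsmul c x hx

end IsCrossedHom

theorem exists_isCrossedHom_freeGroup {ι A : Type*} [AddCommGroup A] [Module Λ A]
    (ψ : FreeGroup ι →* Multiplicative ℤ) (d : ι → A) :
    ∃ D : FreeGroup ι → A, IsCrossedHom ψ D ∧ ∀ i, D (FreeGroup.of i) = d i := by
  let aff : ι → Equiv.Perm A := fun i ↦
    { toFun := fun a ↦ d i + (T (ψ (FreeGroup.of i)).toAdd : Λ) • a
      invFun := fun a ↦ (T (-(ψ (FreeGroup.of i)).toAdd) : Λ) • (a - d i)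
      left_inv := fun a ↦ by simp [T_smul_T_smul]
      right_inv := fun a ↦ by simp [T_smul_T_smul] }
  let ρ : FreeGroup ι →* Equiv.Perm A := FreeGroup.lift aff
  have hof : ∀ i a, ρ (FreeGroup.of i) a = d i + (T (ψ (FreeGroup.of i)).toAdd : Λ) • a :=
    fun i a ↦ by simp [ρ, aff]
  have key : ∀ u a, ρ u a = ρ u 0 + (T (ψ u).toAdd : Λ) • a := by
    intro u
    induction u using FreeGroup.induction_on with
    | C1 => simp
    | of i => intro a; simp [hof]
    | inv_of i ih =>
      intro a
      rw [map_inv, Equiv.Perm.inv_eq_iff_eq, hof, smul_add]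
      have h0 := hof i ((ρ (FreeGroup.of i))⁻¹ 0)
      rw [Equiv.Perm.inv_def, Equiv.apply_symm_apply, ← Equiv.Perm.inv_def] at h0
      rw [← add_assoc, ← h0]
      simp [T_smul_T_smul]
    | mul x y hx hy =>
      intro a
      simp only [map_mul, Equiv.Perm.mul_apply]
      rw [hx (ρ y a), hy a, hx (ρ y 0)]
      simp [T_smul_T_smul, add_assoc]
  exact ⟨fun u ↦ ρ u 0, fun u v ↦ by simp only [map_mul, Equiv.Perm.mul_apply]; exact key u _,
    fun i ↦ by simp [hof]⟩

/-- The Nielsen automorphism of a free group multiplying the generator `i` on the right by the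
`s`-th power of the generator `j`. -/
def FreeGroup.transvection {ι : Type*} [DecidableEq ι] (i j : ι) (hij : i ≠ j) (s : ℤ) :
    FreeGroup ι ≃* FreeGroup ι :=
  MonoidHom.toMulEquiv
    (FreeGroup.lift fun k ↦ if k = i then FreeGroup.of i * FreeGroup.of j ^ s else FreeGroup.of k)
    (FreeGroup.lift fun k ↦
      if k = i then FreeGroup.of i * FreeGroup.of j ^ (-s) else FreeGroup.of k)
    (by ext k; by_cases hk : k = i <;> simp [hk, hij.symm])
    (by ext k; by_cases hk : k = i <;> simp [hk, hij.symm])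

theorem FreeGroup.transvection_of {ι : Type*} [DecidableEq ι] (i j : ι) (hij : i ≠ j) (s : ℤ)
    (k : ι) : FreeGroup.transvection i j hij s (FreeGroup.of k) =
      if k = i then FreeGroup.of i * FreeGroup.of j ^ s else FreeGroup.of k := by
  simp [FreeGroup.transvection]

/-- A homomorphism from a free group of finite rank to `ℤ` kills all but at most one element of
a suitable basis. -/
theorem FreeGroup.exists_mulEquiv_map_eq_one {ι : Type*} [Fintype ι] [Nonempty ι]
    (ψ : FreeGroup ι →* Multiplicative ℤ) :
    ∃ (α : FreeGroup ι ≃* FreeGroup ι) (i₀ : ι), ∀ i ≠ i₀, ψ (α (FreeGroup.of i)) = 1 := by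
  classical
  induction hn : ∑ i, (ψ (FreeGroup.of i)).toAdd.natAbs using Nat.strong_induction_on
    generalizing ψ with
  | _ n ih =>
    by_cases h : ∃ i₀, ∀ i ≠ i₀, ψ (FreeGroup.of i) = 1
    · obtain ⟨i₀, h⟩ := h
      exact ⟨MulEquiv.refl _, i₀, h⟩
    have hpair : ∃ i j, i ≠ j ∧ (ψ (FreeGroup.of j)).toAdd ≠ 0 ∧
        (ψ (FreeGroup.of j)).toAdd.natAbs ≤ (ψ (FreeGroup.of i)).toAdd.natAbs := by
      push Not at h
      obtain ⟨a, -, ha⟩ := h (Classical.arbitrary ι)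
      obtain ⟨b, hba, hb⟩ := h a
      rcases le_total (ψ (FreeGroup.of a)).toAdd.natAbs (ψ (FreeGroup.of b)).toAdd.natAbs
        with hle | hle
      · exact ⟨b, a, hba, by simpa using ha, hle⟩
      · exact ⟨a, b, hba.symm, by simpa using hb, hle⟩
    obtain ⟨i, j, hij, hj, hle⟩ := hpair
    set q := (ψ (FreeGroup.of i)).toAdd / (ψ (FreeGroup.of j)).toAdd with hq
    set τ := FreeGroup.transvection i j hij (-q) with hτ
    have hτi : (ψ (τ (FreeGroup.of i))).toAdd =
        (ψ (FreeGroup.of i)).toAdd % (ψ (FreeGroup.of j)).toAdd := by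
      rw [hτ, FreeGroup.transvection_of, if_pos rfl, _root_.map_mul, map_zpow, toAdd_mul, toAdd_zpow,
        Int.emod_def, ← hq, smul_eq_mul]
      ring
    have hτk : ∀ k ≠ i, τ (FreeGroup.of k) = FreeGroup.of k := fun k hk ↦ by
      rw [hτ, FreeGroup.transvection_of, if_neg hk]
    have hlt : ∑ k, ((ψ.comp τ.toMonoidHom) (FreeGroup.of k)).toAdd.natAbs < n := by
      rw [← hn]
      have hi : (ψ (τ (FreeGroup.of i))).toAdd.natAbs < (ψ (FreeGroup.of i)).toAdd.natAbs := by
        rw [hτi]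
        have h1 := Int.emod_nonneg (ψ (FreeGroup.of i)).toAdd hj
        have h2 := Int.emod_lt (ψ (FreeGroup.of i)).toAdd hj
        omega
      refine Finset.sum_lt_sum (fun k _ ↦ ?_) ⟨i, Finset.mem_univ _, hi⟩
      by_cases hk : k = i
      · subst hk; exact hi.le
      · simp [hτk k hk]
    obtain ⟨α, i₀, hα⟩ := ih _ hlt (ψ.comp τ.toMonoidHom) rfl
    exact ⟨α.trans τ, i₀, fun k hk ↦ by simpa using hα k hk⟩

/-- If a crossed homomorphism `δ` presents `M` as the abelianization of `ker φ`, and `D` is a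
lift of `δ` along `π` with values in `A`, then the values of `D` at the relators span the kernel
of `A → M`. -/
theorem IsCrossedHom.surjective_and_ker_eq_span {F G A M : Type*} [Group F] [Group G]
    [AddCommGroup A] [Module Λ A] [AddCommGroup M] [Module Λ M]
    {φ : G →* Multiplicative ℤ} {δ : G → M} {π : F →* G} {D : F → A} {p : A →ₗ[Λ] M} {z : F}
    {R : Set F} (hδ : ∀ m, ∃ h, φ h = 1 ∧ δ h = m)
    (hker : ∀ h, φ h = 1 → δ h = 0 → h ∈ ⁅φ.ker, φ.ker⁆)
    (hδone : δ 1 = 0) (hπ : Function.Surjective π)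
    (hR : Subgroup.normalClosure R = π.ker)
    (hD : IsCrossedHom (φ.comp π) D) (hz : φ (π z) = Multiplicative.ofAdd 1) (hDz : D z = 0)
    (hspan : Submodule.span Λ (Set.range D) = ⊤) (hp : ∀ u, p (D u) = δ (π u)) :
    Function.Surjective p ∧ Submodule.span Λ (D '' R) = LinearMap.ker p := by
  refine ⟨fun m ↦ ?_, le_antisymm ?_ fun a ha ↦ ?_⟩
  · obtain ⟨h, -, rfl⟩ := hδ m
    obtain ⟨u, rfl⟩ := hπ h
    exact ⟨D u, hp u⟩
  · rw [Submodule.span_le]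
    rintro _ ⟨w, hw, rfl⟩
    have hw : π w = 1 := by
      have := hR ▸ Subgroup.subset_normalClosure hw
      exact this
    simp [hp, hw, hδone]
  · obtain ⟨w, hw, rfl⟩ := hD.exists_mem_ker_eq hz hDz hspan a
    have hw' : δ (π w) = 0 := by rw [← hp]; exact ha
    have hcomm : π w ∈ Subgroup.map π ⁅(φ.comp π).ker, (φ.comp π).ker⁆ := by
      rw [Subgroup.map_commutator, ← MonoidHom.comap_ker,
        Subgroup.map_comap_eq_self_of_surjective hπ]
      exact hker _ hw hw'
    obtain ⟨k, hk, hkw⟩ := hcomm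
    obtain ⟨hk1, hk0⟩ := hD.commutator_le_kerComap hk
    have hle : Subgroup.normalClosure R ≤ hD.kerComap (Submodule.span Λ (D '' R)) := by
      refine Subgroup.normalClosure_le_normal fun x hx ↦ ⟨?_, ?_⟩
      · have : π x = 1 := by
          have := hR ▸ Subgroup.subset_normalClosure hx
          exact this
        simp [this]
      · exact Submodule.subset_span ⟨x, hx, rfl⟩
    have hmem : k⁻¹ * w ∈ Subgroup.normalClosure R := by
      rw [hR]
      simp [MonoidHom.mem_ker, hkw]
    have h := hD k (k⁻¹ * w)
    rw [mul_inv_cancel_left, (Submodule.mem_bot Λ).1 hk0, hk1] at h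
    simp only [toAdd_one, T_zero, one_smul, zero_add] at h
    rw [h]
    exact (hle hmem).2

/-- The abelianization of `ker φ` is presented by the crossed homomorphism
`h ↦ [h * γ₀ ^ (-φ h)]`. -/
theorem exists_isCrossedHom_abelianization {G M : Type*} [Group G] [AddCommGroup M] [Module Λ M]
    (φ : G →* Multiplicative ℤ) {γ γ₀ : G} (hγ : φ γ = Multiplicative.ofAdd 1)
    (hγ₀ : φ γ₀ = Multiplicative.ofAdd 1)
    (e : Additive (Abelianization φ.ker) ≃+ M)
    (ht : ∀ x y : φ.ker, (y : G) = γ * x * γ⁻¹ →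
      (T 1 : Λ) • e (Additive.ofMul (Abelianization.of x)) =
        e (Additive.ofMul (Abelianization.of y))) :
    ∃ δ : G → M, IsCrossedHom φ δ ∧ δ γ₀ = 0 ∧ (∀ m, ∃ h, φ h = 1 ∧ δ h = m) ∧
      ∀ h, φ h = 1 → δ h = 0 → h ∈ ⁅φ.ker, φ.ker⁆ := by
  let cl : φ.ker → M := fun x ↦ e (Additive.ofMul (Abelianization.of x))
  have cl_mul : ∀ x y, cl (x * y) = cl x + cl y := fun x y ↦ by simp [cl]
  have cl_one : cl 1 = 0 := by simp [cl]
  let S : Subgroup G :=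
    { carrier := {h | ∀ x y : φ.ker, (y : G) = h * x * h⁻¹ → (T (φ h).toAdd : Λ) • cl x = cl y}
      one_mem' := fun x y hxy ↦ by
        have : y = x := Subtype.ext (by simpa using hxy)
        simp [this]
      mul_mem' := fun {a b} ha hb x y hxy ↦ by
        have hw : b * (x : G) * b⁻¹ ∈ φ.ker := φ.normal_ker.conj_mem _ x.2 b
        rw [map_mul, toAdd_mul, ← T_smul_T_smul, hb x ⟨_, hw⟩ rfl]
        exact ha _ _ (by rw [hxy]; group)
      inv_mem' := fun {a} ha x y hxy ↦ by
        rw [← ha y x (by rw [hxy]; group), T_smul_T_smul]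
        simp }
  have hker : ∀ h, φ h = 1 → h ∈ S := fun h hh x y hxy ↦ by
    have h1 : y * ⟨h, hh⟩ = ⟨h, hh⟩ * x := Subtype.ext (by simp [hxy])
    have h2 := congrArg cl h1
    rw [cl_mul, cl_mul, add_comm] at h2
    simpa [hh] using (add_left_cancel h2).symm
  have hγS : γ ∈ S := fun x y hxy ↦ by
    rw [hγ]
    exact ht x y hxy
  have hS : ∀ h, h ∈ S := fun h ↦ by
    have := S.mul_mem (S.zpow_mem hγS (φ h).toAdd) (hker (γ ^ (-(φ h).toAdd) * h) (by
      rw [map_mul, map_zpow, hγ, ← ofAdd_zsmul]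
      simp))
    simpa using this
  have hmem : ∀ h, h * γ₀ ^ (-(φ h).toAdd) ∈ φ.ker := fun h ↦ by
    rw [MonoidHom.mem_ker, map_mul, map_zpow, hγ₀, ← ofAdd_zsmul]
    simp
  have hδ : ∀ x : φ.ker, cl ⟨_, hmem x⟩ = cl x := fun x ↦ by
    congr 1
    exact Subtype.ext (by simp [show φ (x : G) = 1 from x.2])
  refine ⟨fun h ↦ cl ⟨_, hmem h⟩, fun u v ↦ ?_, ?_, fun m ↦ ?_, fun h hh h0 ↦ ?_⟩
  · have hpow : φ (γ₀ ^ (φ u).toAdd) = φ u := by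
      rw [map_zpow, hγ₀, ← ofAdd_zsmul]
      simp
    have hconj := φ.normal_ker.conj_mem _ (hmem v) (γ₀ ^ (φ u).toAdd)
    have hact := hS (γ₀ ^ (φ u).toAdd) ⟨_, hmem v⟩ ⟨_, hconj⟩ rfl
    rw [hpow] at hact
    rw [hact, ← cl_mul]
    refine congrArg cl (Subtype.ext ?_)
    simp only [map_mul, toAdd_mul, Subgroup.coe_mul]
    group
  · rw [← cl_one]
    exact congrArg cl (Subtype.ext (by simp [hγ₀]))
  · obtain ⟨a, rfl⟩ := e.surjective m
    obtain ⟨x, hx⟩ := QuotientGroup.mk_surjective a.toMul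
    refine ⟨x, x.2, (hδ x).trans ?_⟩
    exact congrArg (fun y ↦ e (Additive.ofMul y)) hx
  · have h1 : cl ⟨h, hh⟩ = 0 := (hδ ⟨h, hh⟩).symm.trans h0
    have h2 : (⟨h, hh⟩ : φ.ker) ∈ commutator φ.ker := by
      rw [← Abelianization.ker_of, MonoidHom.mem_ker]
      exact Additive.ofMul.injective (e.injective (h1.trans (map_zero e).symm))
    rw [← Subgroup.map_subtype_commutator]
    exact ⟨_, h2, rfl⟩

theorem isUnit_toAdd_of_surjective {ι : Type*} {ψ : FreeGroup ι →* Multiplicative ℤ}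
    (hψ : Function.Surjective ψ) {i₀ : ι} (h : ∀ i ≠ i₀, ψ (FreeGroup.of i) = 1) :
    IsUnit (ψ (FreeGroup.of i₀)).toAdd := by
  have hdvd : ∀ u, (ψ (FreeGroup.of i₀)).toAdd ∣ (ψ u).toAdd := fun u ↦ by
    induction u using FreeGroup.induction_on with
    | C1 => simp
    | of i =>
      by_cases hi : i = i₀
      · rw [hi]
      · simp [h i hi]
    | inv_of i ih => simpa using ih
    | mul x y hx hy => simpa using dvd_add hx hy
  obtain ⟨u, hu⟩ := hψ (Multiplicative.ofAdd 1)
  exact isUnit_of_dvd_one (by simpa [hu] using hdvd u)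

/-- If `G` has a finite presentation with `g` generators and `r` relations,
`φ : G → ℤ` is surjective with kernel `H`, and `γ ∈ G` has `φ(γ) = 1`, then the
abelianization of `H`, as a `Λ`-module with `t` acting by the automorphism
induced by conjugation by `γ`, admits a finite presentation with `g − 1`
generators and `r` relations (so its deficiency is at least `def(G) − 1`). -/
theorem modPres_abelianization_of_ker
    (G : Type) [Group G] (g r : ℕ) (hG : GroupPres G g r)
    (φ : G →* Multiplicative ℤ) (hφ : Function.Surjective φ)
    (γ : G) (hγ : φ γ = Multiplicative.ofAdd 1)
    (M : Type) [AddCommGroup M] [Module Λ M]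
    (e : Additive (Abelianization (MonoidHom.ker φ)) ≃+ M)
    (ht : ∀ x : MonoidHom.ker φ,
      (T 1 : Λ) • e (Additive.ofMul (Abelianization.of x)) =
        e (Additive.ofMul (Abelianization.of
          (⟨γ * (x : G) * γ⁻¹, by
            have h : φ (x : G) = 1 := x.2
            simp [MonoidHom.mem_ker, h]⟩ : MonoidHom.ker φ)))) :
    ModPres M (g - 1) r := by
  obtain ⟨π, R, hπ, hRcard, hR⟩ := hG
  have hψ : Function.Surjective (φ.comp π) := hφ.comp hπ
  have : Nonempty (Fin g) := by
    by_contra hempty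
    rw [not_nonempty_iff] at hempty
    obtain ⟨u, hu⟩ := hψ (Multiplicative.ofAdd 1)
    rw [Subsingleton.elim u 1, map_one] at hu
    exact absurd hu (by decide)
  obtain ⟨α, i₀, hα⟩ := FreeGroup.exists_mulEquiv_map_eq_one (φ.comp π)
  have hunit := isUnit_toAdd_of_surjective (ψ := (φ.comp π).comp α.toMonoidHom)
    (hψ.comp α.surjective) hα
  set x₀ := α (FreeGroup.of i₀) with hx₀
  set s : ℤ := (φ (π x₀)).toAdd with hs
  have hss : s * s = 1 := Int.isUnit_mul_self hunit
  have hz : φ (π (x₀ ^ s)) = Multiplicative.ofAdd 1 := by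
    apply Multiplicative.toAdd.injective
    rw [map_zpow, map_zpow, toAdd_zpow, ← hs, smul_eq_mul, hss, toAdd_ofAdd]
  obtain ⟨δ, hδ, hδz, hδsurj, hδker⟩ := exists_isCrossedHom_abelianization φ hγ hz e
    fun x y hxy ↦ (ht x).trans (by
      congr 3
      exact Subtype.ext hxy.symm)
  have hδx₀ : δ (π x₀) = 0 := by
    have h := hδ.zeros.zpow_mem hδz s
    rwa [← map_zpow, ← zpow_mul, hss, zpow_one] at h
  let b : {i // i ≠ i₀} ≃ Fin (g - 1) := Fintype.equivFinOfCardEq (by simp)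
  let p : (Fin (g - 1) → Λ) →ₗ[Λ] M :=
    Fintype.linearCombination Λ fun k ↦ δ (π (α (FreeGroup.of (b.symm k : Fin g))))
  obtain ⟨D₀, hD₀, hD₀of⟩ := exists_isCrossedHom_freeGroup ((φ.comp π).comp α.toMonoidHom)
    fun i ↦ if h : i ≠ i₀ then (Pi.single (b ⟨i, h⟩) 1 : Fin (g - 1) → Λ) else 0
  have hpD₀ : p ∘ D₀ = (δ ∘ π) ∘ α.toMonoidHom := by
    refine (hD₀.map_linear p).ext_freeGroup ((hδ.comp π).comp α.toMonoidHom) fun i ↦ ?_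
    by_cases hi : i = i₀
    · subst hi
      simpa [hD₀of] using hδx₀.symm
    · simp [hD₀of, hi, p, Fintype.linearCombination_apply_single]
  have hD : IsCrossedHom (φ.comp π) (D₀ ∘ α.symm) := by
    have h := hD₀.comp α.symm.toMonoidHom
    have hψα : ((φ.comp π).comp α.toMonoidHom).comp α.symm.toMonoidHom = φ.comp π := by
      ext
      simp
    rwa [hψα] at h
  have hDz : (D₀ ∘ α.symm) (x₀ ^ s) = 0 :=
    hD.zeros.zpow_mem (show (D₀ ∘ α.symm) x₀ = 0 by simp [hx₀, hD₀of]) s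
  have hspan : Submodule.span Λ (Set.range (D₀ ∘ α.symm)) = ⊤ := by
    rw [eq_top_iff, ← (Pi.basisFun Λ (Fin (g - 1))).span_eq]
    refine Submodule.span_mono ?_
    rintro _ ⟨k, rfl⟩
    refine ⟨α (FreeGroup.of (b.symm k : Fin g)), ?_⟩
    simp [hD₀of, (b.symm k).2]
  obtain ⟨hsurj, hker⟩ := hD.surjective_and_ker_eq_span (p := p) hδsurj hδker hδ.map_one hπ hR hz
    hDz hspan fun u ↦ by simpa using congrFun hpD₀ (α.symm u)
  let c : R ≃ Fin r := R.equivFinOfCardEq hRcard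
  refine ⟨Fintype.linearCombination Λ fun k ↦ (D₀ ∘ α.symm) (c.symm k), p, hsurj, ?_⟩
  rw [Fintype.range_linearCombination, ← hker]
  congr 1
  ext a
  constructor
  · rintro ⟨k, rfl⟩
    exact ⟨_, (c.symm k).2, rfl⟩
  · rintro ⟨w, hw, rfl⟩
    exact ⟨c ⟨w, hw⟩, by simp⟩
end

section
/- Let Λ = ℤ[t, t⁻¹], let K be the fraction field of Λ, and let M be a Λ-module admitting an exact sequence Λ^r → Λ^g → M → 0. Let r₀ = dim_K (K ⊗_Λ M). Then the Λ-module Ext²_Λ(M, Λ) can be generated by r₀ − (g − r) elements, i.e., there is a spanning set of Ext²_Λ(M, Λ) of cardinality at most r₀ + r − g. -/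
open TensorProduct CategoryTheory

/-- `K`, the fraction field of `Λ`. -/
abbrev K : Type := FractionRing Λ

/-- `Ext²_Λ(M, Λ)`, the second Ext group of `M` with coefficients in `Λ`
in the category of `Λ`-modules, as a `Λ`-module. -/
noncomputable abbrev Ext2 (M : Type) [AddCommGroup M] [Module Λ M] : ModuleCat Λ :=
  ((Ext Λ (ModuleCat Λ) 2).obj (Opposite.op (ModuleCat.of Λ M))).obj (ModuleCat.of Λ Λ)

theorem LaurentPolynomial.isPrincipalIdealRing (F : Type*) [Field F] :
    IsPrincipalIdealRing (LaurentPolynomial F) where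
  principal I := by
    obtain ⟨q, hq⟩ := IsPrincipalIdealRing.principal
      (I.comap (algebraMap (Polynomial F) (LaurentPolynomial F)))
    refine ⟨algebraMap _ _ q, ?_⟩
    rw [← IsLocalization.map_under (Submonoid.powers (Polynomial.X : Polynomial F)) _ I,
      Ideal.under_def, hq]
    exact (Ideal.map_span _ _).trans (by rw [Set.image_singleton])

theorem LaurentPolynomial.mapRingHom_zmod_surjective (p : ℕ) :
    Function.Surjective (AddMonoidAlgebra.mapRingHom ℤ (Int.castRingHom (ZMod p))) := by
  intro x
  induction x using AddMonoidAlgebra.induction_linear with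
  | zero => exact ⟨0, map_zero _⟩
  | add a b ha hb =>
    obtain ⟨a, rfl⟩ := ha
    obtain ⟨b, rfl⟩ := hb
    exact ⟨a + b, map_add _ _ _⟩
  | single m c =>
    obtain ⟨c, rfl⟩ := ZMod.intCast_surjective c
    exact ⟨.single m c, AddMonoidAlgebra.mapRingHom_single ..⟩

theorem LaurentPolynomial.exists_eq_natCast_mul_of_mapRingHom_zmod_eq_zero (p : ℕ)
    (x : LaurentPolynomial ℤ)
    (hx : AddMonoidAlgebra.mapRingHom ℤ (Int.castRingHom (ZMod p)) x = 0) :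
    ∃ y, x = (p : LaurentPolynomial ℤ) * y := by
  have h : ∀ m, (p : ℤ) ∣ x.coeff m := fun m => by
    rw [← ZMod.intCast_zmod_eq_zero_iff_dvd]
    simpa using congrArg (fun z => z.coeff m) hx
  refine ⟨.ofCoeff (x.coeff.mapRange (· / (p : ℤ)) (by simp)), ?_⟩
  rw [← nsmul_eq_mul]
  ext m
  rw [AddMonoidAlgebra.coeff_smul]
  simp [Int.mul_ediv_cancel' (h m)]

theorem LaurentPolynomial.exists_natCast_mul_mem_range (x : LaurentPolynomial ℚ) :
    ∃ a : ℕ, a ≠ 0 ∧ (a : LaurentPolynomial ℚ) * x ∈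
      (AddMonoidAlgebra.mapRingHom ℤ (Int.castRingHom ℚ)).range := by
  induction x using AddMonoidAlgebra.induction_linear with
  | zero => exact ⟨1, one_ne_zero, by simp⟩
  | add x y hx hy =>
    obtain ⟨a, ha, hx⟩ := hx
    obtain ⟨b, hb, hy⟩ := hy
    refine ⟨a * b, mul_ne_zero ha hb, ?_⟩
    have := add_mem (mul_mem (natCast_mem _ b) hx) (mul_mem (natCast_mem _ a) hy)
    convert this using 1
    push_cast
    ring
  | single m c =>
    refine ⟨c.den, c.den_nz, .single m c.num, ?_⟩
    rw [← nsmul_eq_mul, AddMonoidAlgebra.smul_single]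
    refine (AddMonoidAlgebra.mapRingHom_single ..).trans ?_
    simp [Rat.den_mul_eq_num]

theorem LaurentPolynomial.mapRingHom_rat_injective :
    Function.Injective (AddMonoidAlgebra.mapRingHom ℤ (Int.castRingHom ℚ)) := by
  intro x y h
  ext m
  simpa using congrArg (fun z => z.coeff m) h

/-- If `E` has `n` generators modulo every prime, it has `n` generators modulo any nonzero
integer. -/
theorem exists_span_range_modulo_natCast {A E : Type*} [CommRing A] [AddCommGroup E] [Module A E]
    (n : ℕ) (h : ∀ p : ℕ, p.Prime → ∃ x : Fin n → E, ∀ e : E, ∃ y : E,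
      e - p • y ∈ Submodule.span A (Set.range x)) (a : ℕ) (ha : a ≠ 0) :
    ∃ x : Fin n → E, ∀ e : E, ∃ y : E, e - a • y ∈ Submodule.span A (Set.range x) := by
  have key (S : Submodule A E) (a b : ℕ) (hA : ∀ e : E, ∃ y : E, e - a • y ∈ S)
      (hB : ∀ e : E, ∃ y : E, e - b • y ∈ S) (e : E) : ∃ y : E, e - (a * b) • y ∈ S := by
    obtain ⟨y, hy⟩ := hA e
    obtain ⟨z, hz⟩ := hB y
    refine ⟨z, ?_⟩
    have := add_mem hy (S.smul_of_tower_mem a hz)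
    rwa [smul_sub, sub_add_sub_cancel, smul_smul] at this
  have hadjust (a : ℤ) (x z : Fin n → E)
      (hx : ∀ e : E, ∃ y : E, e - a • y ∈ Submodule.span A (Set.range x))
      (w : Fin n → E) (hw : ∀ i, z i = x i + a • w i) (e : E) :
      ∃ y : E, e - a • y ∈ Submodule.span A (Set.range z) := by
    obtain ⟨y, hy⟩ := hx e
    obtain ⟨c, hc⟩ := (Submodule.mem_span_range_iff_exists_fun A).1 hy
    refine ⟨y - ∑ i, c i • w i, (Submodule.mem_span_range_iff_exists_fun A).2 ⟨c, ?_⟩⟩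
    simp only [hw, smul_add, Finset.sum_add_distrib, hc, smul_sub, Finset.smul_sum]
    simp only [smul_comm a]
    abel
  induction a using Nat.recOnPrimeCoprime with
  | zero => exact (ha rfl).elim
  | prime_pow p k hp =>
    obtain ⟨x, hx⟩ := h p hp
    refine ⟨x, ?_⟩
    induction k with
    | zero => exact fun e => ⟨e, by simp⟩
    | succ k ih =>
      rw [pow_succ]
      exact key _ _ _ (ih (pow_ne_zero _ hp.ne_zero)) hx
  | coprime a b ha' hb' hab iha ihb =>
    obtain ⟨x, hx⟩ := iha (by omega)
    obtain ⟨y, hy⟩ := ihb (by omega)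
    obtain ⟨u, v, huv⟩ := Nat.isCoprime_iff_coprime.2 hab
    refine ⟨fun i => (v * b) • x i + (u * a) • y i, key _ _ _ ?_ ?_⟩
    · simp only [← natCast_zsmul] at hx ⊢
      refine hadjust a x _ hx (fun i => u • (y i - x i)) fun i => ?_
      rw [show v * b = 1 - u * a by linarith]
      module
    · simp only [← natCast_zsmul] at hy ⊢
      refine hadjust b y _ hy (fun i => v • (x i - y i)) fun i => ?_
      rw [show u * a = 1 - v * b by linarith]
      module

/-- A `ϖ`-saturated submodule of a free module, where `A ⧸ (ϖ)` is a principal ideal domain, is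
generated modulo `ϖ` by linearly independent elements. -/
theorem Submodule.exists_linearIndependent_modulo {A R : Type*} [CommRing A] [IsDomain A]
    [IsNoetherianRing A] [CommRing R] [IsDomain R] [IsPrincipalIdealRing R] (φ : A →+* R)
    (hφ : Function.Surjective φ) (ϖ : A) (hϖ₀ : ϖ ≠ 0) (hϖ : φ ϖ = 0)
    (hker : ∀ x, φ x = 0 → ∃ y, x = ϖ * y) {r : ℕ} (N : Submodule A (Fin r → A))
    (hN : ∀ w, ϖ • w ∈ N → w ∈ N) :
    ∃ (k : ℕ) (e : Fin k → N), LinearIndependent A e ∧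
      ∀ v : N, ∃ w : N, v - ϖ • w ∈ Submodule.span A (Set.range e) := by
  have : RingHomSurjective φ := ⟨hφ⟩
  let σ : (Fin r → A) →ₛₗ[φ] (Fin r → R) :=
    { toFun v i := φ (v i)
      map_add' _ _ := by ext; simp
      map_smul' _ _ := by ext; simp }
  have hσ (v : Fin r → A) (hv : σ v = 0) : ∃ w, v = ϖ • w := by
    choose w hw using fun i => hker (v i) (congrFun hv i)
    exact ⟨w, funext hw⟩
  obtain ⟨k, ⟨b⟩⟩ := Submodule.nonempty_basis_of_pid (Pi.basisFun R (Fin r)) (N.map σ)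
  choose e heN he using fun i => Submodule.mem_map.1 (b i).2
  have hcomb (c : Fin k → A) : σ (∑ i, c i • e i) = (∑ i, φ (c i) • b i : N.map σ) := by
    simp [he]
  refine ⟨k, fun i => ⟨e i, heN i⟩, ?_, fun v => ?_⟩
  · let T := Fintype.linearCombination A fun i => (⟨e i, heN i⟩ : N)
    have hT (c : Fin k → A) : ((T c : N) : Fin r → A) = ∑ i, c i • e i := by
      simp [T, Fintype.linearCombination_apply]
    have hle : LinearMap.ker T ≤ Ideal.span {ϖ} • LinearMap.ker T := by
      intro c hc
      have hc0 : ∑ i, c i • e i = 0 := by rw [← hT, LinearMap.mem_ker.1 hc]; rfl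
      have h0 : ∑ i, φ (c i) • b i = 0 := by
        apply Subtype.ext
        rw [← hcomb, hc0]
        exact map_zero σ
      choose d hd using fun i => hker (c i) (Fintype.linearIndependent_iff.1 b.linearIndependent
        (fun i => φ (c i)) h0 i)
      obtain rfl : c = ϖ • d := funext hd
      refine Submodule.smul_mem_smul (Ideal.mem_span_singleton_self ϖ) ?_
      rw [LinearMap.mem_ker, map_smul] at hc
      exact (smul_eq_zero.1 hc).resolve_left hϖ₀
    obtain ⟨s, hs, hsT⟩ := Submodule.exists_sub_one_mem_and_smul_eq_zero_of_fg_of_le_smul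
      _ _ (IsNoetherian.noetherian _) hle
    have hs0 : s ≠ 0 := by
      rintro rfl
      obtain ⟨y, hy⟩ := Ideal.mem_span_singleton.1 hs
      simpa [hϖ] using congrArg φ hy
    rw [Fintype.linearIndependent_iff]
    intro c hc i
    have := hsT c (by simpa [T, Fintype.linearCombination_apply] using hc)
    exact congrFun ((smul_eq_zero.1 this).resolve_left hs0) i
  · choose c hc using fun i => hφ (b.repr ⟨σ v, Submodule.mem_map_of_mem v.2⟩ i)
    have h0 : σ (v - ∑ i, c i • e i) = 0 := by
      rw [map_sub, hcomb]
      simp only [hc]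
      rw [b.sum_repr]
      exact sub_self _
    obtain ⟨w, hw⟩ := hσ _ h0
    have hwN : w ∈ N := hN w (hw ▸ sub_mem v.2 (sum_mem fun i _ => N.smul_mem _ (heN i)))
    refine ⟨⟨w, hwN⟩, (Submodule.mem_span_range_iff_exists_fun A).2 ⟨c, Subtype.ext ?_⟩⟩
    simp [← hw]

theorem Module.Dual.exists_span_range_modulo {A N : Type*} [CommRing A] [AddCommGroup N]
    [Module A N] [Module.Finite A N] (ϖ : A) {k : ℕ} (e : Fin k → N) (he : LinearIndependent A e)
    (hspan : ∀ v : N, ∃ w : N, v - ϖ • w ∈ Submodule.span A (Set.range e)) :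
    ∃ x : Fin k → Module.Dual A N, ∀ ψ : Module.Dual A N, ∃ y : Module.Dual A N,
      ψ - ϖ • y ∈ Submodule.span A (Set.range x) := by
  set S := Submodule.span A (Set.range e) with hS
  have hle : (⊤ : Submodule A (N ⧸ S)) ≤ Ideal.span {ϖ} • ⊤ := by
    rintro v -
    obtain ⟨v, rfl⟩ := S.mkQ_surjective v
    obtain ⟨w, hw⟩ := hspan v
    rw [← Submodule.ker_mkQ S, LinearMap.mem_ker, map_sub, sub_eq_zero] at hw
    rw [hw, map_smul]
    exact Submodule.smul_mem_smul (Ideal.mem_span_singleton_self ϖ) trivial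
  obtain ⟨s, hs, hsS⟩ := Submodule.exists_sub_one_mem_and_smul_eq_zero_of_fg_of_le_smul
    _ _ Module.Finite.fg_top hle
  have hsS (v : N) : s • v ∈ S := by
    rw [← Submodule.ker_mkQ S, LinearMap.mem_ker, map_smul]
    exact hsS _ trivial
  obtain ⟨u, hu⟩ := Ideal.mem_span_singleton.1 hs
  let b : Module.Basis (Fin k) A S := Module.Basis.span he
  let m : N →ₗ[A] S := (LinearMap.lsmul A N s).codRestrict S hsS
  refine ⟨fun i => b.coord i ∘ₗ m, fun ψ => ⟨-(u • ψ),
    (Submodule.mem_span_range_iff_exists_fun A).2 ⟨fun i => ψ (e i), ?_⟩⟩⟩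
  ext v
  have hv : s • v = ∑ i, b.coord i (m v) • e i := by
    have hb (i) : (b i : N) = e i :=
      congrArg Subtype.val (Module.Basis.span_apply he i)
    have := congrArg S.subtype (b.sum_repr (m v))
    simp only [map_sum, map_smul, Submodule.subtype_apply, hb] at this
    exact this.symm
  have hψ := congrArg ψ hv
  simp only [map_smul, map_sum, smul_eq_mul] at hψ
  simp only [LinearMap.sum_apply, LinearMap.smul_apply, LinearMap.sub_apply, LinearMap.neg_apply,
    LinearMap.comp_apply, smul_eq_mul]
  rw [Finset.sum_congr rfl fun i _ => mul_comm _ _, ← hψ]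
  linear_combination (ψ v) * hu

theorem LinearMap.exists_projection_ker_of_pid {R : Type*} [CommRing R] [IsDomain R]
    [IsPrincipalIdealRing R] {r g : ℕ} (f : (Fin r → R) →ₗ[R] (Fin g → R)) :
    ∃ P : (Fin r → R) →ₗ[R] (Fin r → R), f ∘ₗ P = 0 ∧ ∀ v, f v = 0 → P v = v := by
  obtain ⟨k, ⟨b⟩⟩ := Submodule.nonempty_basis_of_pid (Pi.basisFun R (Fin g)) (LinearMap.range f)
  have : Module.Projective R (LinearMap.range f) := Module.Projective.of_basis b
  obtain ⟨h, hh⟩ := Module.projective_lifting_property f.rangeRestrict .id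
    f.surjective_rangeRestrict
  refine ⟨.id - h ∘ₗ f.rangeRestrict, ?_, fun v hv => ?_⟩
  · refine LinearMap.ext fun v => ?_
    have : f (h (f.rangeRestrict v)) = f v :=
      congrArg Subtype.val (LinearMap.congr_fun hh (f.rangeRestrict v))
    simp [this]
  · have : f.rangeRestrict v = 0 := Subtype.ext hv
    simp [this]

/-- A nonzero integer multiple of the identity of `ker f` extends to a map into `ker f`. -/
theorem LaurentPolynomial.exists_nsmul_projection_ker {r g : ℕ}
    (f : (Fin r → LaurentPolynomial ℤ) →ₗ[LaurentPolynomial ℤ] (Fin g → LaurentPolynomial ℤ)) :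
    ∃ a : ℕ, a ≠ 0 ∧ ∃ P : (Fin r → LaurentPolynomial ℤ) →ₗ[LaurentPolynomial ℤ]
      (Fin r → LaurentPolynomial ℤ), f ∘ₗ P = 0 ∧ ∀ v, f v = 0 → P v = a • v := by
  have := LaurentPolynomial.isPrincipalIdealRing ℚ
  let φ : LaurentPolynomial ℤ →+* LaurentPolynomial ℚ :=
    AddMonoidAlgebra.mapRingHom ℤ (Int.castRingHom ℚ)
  have hφ : Function.Injective φ := mapRingHom_rat_injective
  let F := LinearMap.toMatrix' f
  obtain ⟨P, hfP, hP⟩ := LinearMap.exists_projection_ker_of_pid (Matrix.toLin' (F.map φ))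
  let Q := LinearMap.toMatrix' P
  have hFQ : F.map φ * Q = 0 := by
    rw [← LinearMap.toMatrix'_toLin' (F.map φ), ← LinearMap.toMatrix'_comp, hfP, map_zero]
  choose a ha Q' hQ' using fun i j => exists_natCast_mul_mem_range (Q i j)
  let d := ∏ i, ∏ j, a i j
  have hd : d ≠ 0 := Finset.prod_ne_zero_iff.2 fun i _ => Finset.prod_ne_zero_iff.2 fun j _ => ha i j
  have hdvd (i j) : a i j ∣ d :=
    (Finset.dvd_prod_of_mem _ (Finset.mem_univ j)).trans
      (Finset.dvd_prod_of_mem (fun i => ∏ j, a i j) (Finset.mem_univ i))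
  choose c hc using hdvd
  let P' : Matrix (Fin r) (Fin r) (LaurentPolynomial ℤ) := .of fun i j => c i j * Q' i j
  have hP' : P'.map φ = d • Q := by
    ext1 i j
    have : φ (Q' i j) = a i j * Q i j := hQ' i j
    rw [Matrix.smul_apply, nsmul_eq_mul, hc i j]
    simp [P', this]
    ring
  refine ⟨d, hd, Matrix.toLin' P', ?_, fun v hv => ?_⟩
  · rw [← LinearMap.toMatrix'.map_eq_zero_iff, LinearMap.toMatrix'_comp, LinearMap.toMatrix'_toLin']
    refine Matrix.map_injective hφ ?_
    change (F * P').map φ = _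
    rw [Matrix.map_mul, hP', Matrix.mul_smul, hFQ, smul_zero]
    exact (Matrix.map_zero _ (map_zero φ)).symm
  · have h1 : P (φ ∘ v) = φ ∘ v := by
      refine hP _ ?_
      rw [Matrix.toLin'_apply]
      ext1 i
      rw [← RingHom.map_mulVec]
      have : F.mulVec v = 0 := by rw [← hv, ← Matrix.toLin'_apply, Matrix.toLin'_toMatrix']
      simp [this]
    refine hφ.comp_left ?_
    rw [Matrix.toLin'_apply]
    change φ ∘ (P'.mulVec v) = φ ∘ (d • v)
    have h2 : φ ∘ (P'.mulVec v) = (P'.map φ).mulVec (φ ∘ v) := funext fun i => φ.map_mulVec ..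
    rw [h2, hP', Matrix.smul_mulVec, ← Matrix.toLin'_apply, Matrix.toLin'_toMatrix', h1]
    ext1 i
    simp

section

variable {C : Type*} [Category* C] [Abelian C] [EnoughProjectives C]
  {X₀ X₁ Z : C} (d : X₁ ⟶ X₀) (π : X₀ ⟶ Z)

namespace CategoryTheory.ProjectiveResolution

lemma projective_d_comp {X Y : C} (f : X ⟶ Y) : Projective.d f ≫ f = 0 :=
  (Category.assoc _ _ _).trans
    ((congrArg _ (Limits.kernel.condition f)).trans Limits.comp_zero)

/-- The chain complex obtained from `d : X₁ ⟶ X₀` by successively adding projective covers of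
kernels. -/
noncomputable def ofPresentationComplex : ChainComplex C ℕ :=
  ChainComplex.mk' X₀ X₁ d (fun f => ⟨_, Projective.d f, projective_d_comp f⟩)

lemma ofPresentationComplex_d_1_0 : (ofPresentationComplex d).d 1 0 = d :=
  ChainComplex.mk'_d_1_0 ..

lemma ofPresentationComplex_exactAt_succ (n : ℕ) :
    (ofPresentationComplex d).ExactAt (n + 1) := by
  rw [HomologicalComplex.exactAt_iff' _ (n + 1 + 1) (n + 1) n (by simp) (by simp)]
  let aux := ChainComplex.mkAux X₀ X₁ _ d _ (projective_d_comp d)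
    (fun S => ⟨_, Projective.d S.f, projective_d_comp S.f⟩)
  have h (m : ℕ) : (ofPresentationComplex d).d (m + 1) m = (aux m).g :=
    ChainComplex.of_d (fun n => (aux n).X₃) (fun n => (aux n).g) m
  have h2 (S : ShortComplex C) (f : S.X₂ ⟶ S.X₃) (g : S.X₁ ⟶ S.X₂) (w : g ≫ f = 0) (hf : S.g = f)
      (hg : S.f = g) (hE : (ShortComplex.mk g f w).Exact) : S.Exact := by
    subst hf hg
    exact hE
  match n with
  | 0 => exact h2 _ _ _ _ (h 0) (h 1) (exact_d_f d)
  | n + 1 => exact h2 _ _ _ _ (h (n + 1)) (h (n + 2)) (exact_d_f _)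

lemma projective_ofPresentationComplex_X [Projective X₀] [Projective X₁] (n : ℕ) :
    Projective ((ofPresentationComplex d).X n) := by
  obtain (_ | _ | _ | n) := n
  · exact ‹Projective X₀›
  · exact ‹Projective X₁›
  all_goals apply Projective.projective_over

/-- The projective resolution of `Z` extending a presentation `X₁ ⟶ X₀ ⟶ Z` by projectives. -/
noncomputable def ofPresentation [Projective X₀] [Projective X₁] [Epi π] (w : d ≫ π = 0)
    (hd : (ShortComplex.mk d π w).Exact) : ProjectiveResolution Z where
  complex := ofPresentationComplex d
  projective := projective_ofPresentationComplex_X d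
  π := (ChainComplex.toSingle₀Equiv _ _).symm ⟨π, (congrArg (· ≫ π)
    (ofPresentationComplex_d_1_0 d)).trans w⟩
  quasiIso := ⟨fun n => by
    cases n
    · rw [ChainComplex.quasiIsoAt₀_iff, ShortComplex.quasiIso_iff_of_zeros']
      · refine (ShortComplex.exact_and_epi_g_iff_of_iso ?_).2
          ⟨hd, ‹Epi π›⟩
        refine ShortComplex.isoMk (Iso.refl _) (Iso.refl _) (Iso.refl _) ?_ ?_
        · refine (Category.id_comp _).trans (Eq.trans ?_ (Category.comp_id _).symm)
          exact (ofPresentationComplex_d_1_0 d).symm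
        · refine (Category.id_comp _).trans (Eq.trans ?_ (Category.comp_id _).symm)
          exact (ChainComplex.toSingle₀Equiv_symm_apply_f_zero (C := ofPresentationComplex d) π _).symm
      all_goals rfl
    · rw [quasiIsoAt_iff_exactAt']
      · apply ofPresentationComplex_exactAt_succ
      · apply ChainComplex.exactAt_succ_single_obj⟩

end CategoryTheory.ProjectiveResolution

end

universe u

/-- The second cohomology of `Hom(C, Y)` is a quotient of the homomorphisms from the first syzygy
to `Y`, in which restrictions from `C.X 1` vanish. -/
theorem exists_surjective_dual_ker {R : Type u} [CommRing R] (C : ChainComplex (ModuleCat.{u} R) ℕ)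
    (hC₁ : C.ExactAt 1) (hC₂ : C.ExactAt 2) (Y : ModuleCat.{u} R) :
    ∃ θ : (LinearMap.ker (C.d 1 0).hom →ₗ[R] Y) →ₗ[R] (C.linearYonedaObj R Y).homology 2,
      Function.Surjective θ ∧
      ∀ χ : C.X 1 →ₗ[R] Y, θ (χ ∘ₗ (LinearMap.ker (C.d 1 0).hom).subtype) = 0 := by
  rw [HomologicalComplex.exactAt_iff' _ 2 1 0 (by simp) (by simp),
    ShortComplex.ShortExact.moduleCat_exact_iff_function_exact] at hC₁
  rw [HomologicalComplex.exactAt_iff' _ 3 2 1 (by simp) (by simp),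
    ShortComplex.ShortExact.moduleCat_exact_iff_function_exact] at hC₂
  let S := (C.linearYonedaObj R Y).sc' 1 2 3
  let iso : (C.linearYonedaObj R Y).homology 2 ≅ S.moduleCatLeftHomologyData.H :=
    ShortComplex.homologyMapIso ((C.linearYonedaObj R Y).isoSc' 1 2 3 (by simp) (by simp)) ≪≫
      S.moduleCatHomologyIso
  have hSg (x : C.X 2 ⟶ Y) : S.g x = C.d 3 2 ≫ x := rfl
  let N := LinearMap.ker (C.d 1 0).hom
  let δ : C.X 2 →ₗ[R] N := (C.d 2 1).hom.codRestrict N fun c => (hC₁ _).2 ⟨c, rfl⟩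
  let pull : (N →ₗ[R] Y) →ₗ[R] LinearMap.ker S.g.hom :=
    LinearMap.codRestrict _
      { toFun ψ := (ModuleCat.ofHom (ψ ∘ₗ δ) : C.X 2 ⟶ Y)
        map_add' _ _ := rfl
        map_smul' _ _ := rfl } fun ψ => by
        refine (hSg _).trans ?_
        refine ModuleCat.hom_ext (LinearMap.ext fun c => ?_)
        have : δ (C.d 3 2 c) = 0 := Subtype.ext ((hC₂ _).2 ⟨c, rfl⟩)
        exact (congrArg ψ this).trans (map_zero ψ)
  have hδ : Function.Surjective δ := fun v => by
    obtain ⟨c, hc⟩ := (hC₁ v.1).1 v.2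
    exact ⟨c, Subtype.ext hc⟩
  refine ⟨iso.inv.hom ∘ₗ (Submodule.mkQ _) ∘ₗ pull, ?_, fun χ => ?_⟩
  · refine (ConcreteCategory.bijective_of_isIso iso.inv).2.comp
      ((Submodule.mkQ_surjective _).comp fun x => ?_)
    let ξ : C.X 2 ⟶ Y := x.1
    have hξ : C.d 3 2 ≫ ξ = 0 := x.2
    have hker : LinearMap.ker δ ≤ LinearMap.ker ξ.hom := fun c hc => by
      obtain ⟨b, rfl⟩ := (hC₂ c).1 (congrArg Subtype.val hc)
      exact congrArg (fun φ : C.X 3 ⟶ Y => φ b) hξ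
    refine ⟨(LinearMap.ker δ).liftQ ξ.hom hker ∘ₗ (δ.quotKerEquivOfSurjective hδ).symm,
      Subtype.ext (ModuleCat.hom_ext (LinearMap.ext fun c => ?_))⟩
    have : (δ.quotKerEquivOfSurjective hδ).symm (δ c) = Submodule.Quotient.mk c :=
      (LinearEquiv.symm_apply_eq _).2 rfl
    exact congrArg ((LinearMap.ker δ).liftQ ξ.hom hker) this
  · have : pull (χ ∘ₗ N.subtype) = S.moduleCatToCycles (ModuleCat.ofHom χ : C.X 1 ⟶ Y) :=
      Subtype.ext rfl
    have h0 : (Submodule.mkQ (LinearMap.range S.moduleCatToCycles)) (pull (χ ∘ₗ N.subtype)) = 0 := by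
      rw [this]
      exact (Submodule.Quotient.mk_eq_zero _).2 ⟨_, rfl⟩
    exact (congrArg iso.inv.hom h0).trans (map_zero _)

theorem exists_surjective_dual_ker_ext {R M : Type u} [CommRing R] [AddCommGroup M] [Module R M]
    {F G : Type u} [AddCommGroup F] [Module R F] [AddCommGroup G] [Module R G]
    [Module.Projective R F] [Module.Projective R G]
    (f : F →ₗ[R] G) (p : G →ₗ[R] M)
    (hp : Function.Surjective p) (hexact : LinearMap.range f = LinearMap.ker p)
    (Y : ModuleCat.{u} R) :
    ∃ θ : (LinearMap.ker f →ₗ[R] Y) →ₗ[R]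
        ((Ext R (ModuleCat R) 2).obj (Opposite.op (ModuleCat.of R M))).obj Y,
      Function.Surjective θ ∧ ∀ χ : F →ₗ[R] Y, θ (χ ∘ₗ (LinearMap.ker f).subtype) = 0 := by
  have : Projective (ModuleCat.of R F) :=
    ModuleCat.projective_of_categoryTheory_projective _
  have : Projective (ModuleCat.of R G) :=
    ModuleCat.projective_of_categoryTheory_projective _
  have : Epi (ModuleCat.ofHom p) := (ModuleCat.epi_iff_surjective _).2 hp
  let d : ModuleCat.of R F ⟶ ModuleCat.of R G := ModuleCat.ofHom f
  let P := ProjectiveResolution.ofPresentation d (ModuleCat.ofHom p)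
    (ModuleCat.hom_ext (LinearMap.range_le_ker_iff.1 hexact.le))
    ((ShortComplex.moduleCat_exact_iff_range_eq_ker _).2 hexact)
  obtain ⟨θ, hθ, h0⟩ := exists_surjective_dual_ker P.complex
    (ProjectiveResolution.ofPresentationComplex_exactAt_succ d 0)
    (ProjectiveResolution.ofPresentationComplex_exactAt_succ d 1) Y
  have hd : P.complex.d 1 0 = d := ProjectiveResolution.ofPresentationComplex_d_1_0 d
  let iso := P.isoExt (R := R) 2 Y
  have key (D : ModuleCat.of R F ⟶ ModuleCat.of R G) (hD : D = d)
      (θ : (LinearMap.ker D.hom →ₗ[R] Y) →ₗ[R] (P.complex.linearYonedaObj R Y).homology 2)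
      (hθ : Function.Surjective θ)
      (h0 : ∀ χ : F →ₗ[R] Y, θ (χ ∘ₗ (LinearMap.ker D.hom).subtype) = 0) :
      ∃ θ : (LinearMap.ker f →ₗ[R] Y) →ₗ[R]
        ((Ext R (ModuleCat R) 2).obj (Opposite.op (ModuleCat.of R M))).obj Y,
      Function.Surjective θ ∧ ∀ χ : F →ₗ[R] Y, θ (χ ∘ₗ (LinearMap.ker f).subtype) = 0 := by
    subst hD
    exact ⟨iso.inv.hom ∘ₗ θ, (ConcreteCategory.bijective_of_isIso iso.inv).2.comp hθ,
      fun χ => (congrArg iso.inv.hom (h0 χ)).trans (map_zero _)⟩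
  exact key _ hd θ hθ h0

theorem LaurentPolynomial.exists_dual_ker_span_range_modulo_prime {r g : ℕ}
    (f : (Fin r → LaurentPolynomial ℤ) →ₗ[LaurentPolynomial ℤ] (Fin g → LaurentPolynomial ℤ))
    (p : ℕ) (hp : p.Prime) :
    ∃ x : Fin (Module.finrank (LaurentPolynomial ℤ) (LinearMap.ker f)) →
        Module.Dual (LaurentPolynomial ℤ) (LinearMap.ker f),
      ∀ ψ, ∃ y, ψ - p • y ∈ Submodule.span (LaurentPolynomial ℤ) (Set.range x) := by
  have : Fact p.Prime := ⟨hp⟩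
  have := LaurentPolynomial.isPrincipalIdealRing (ZMod p)
  have hp₀ : (p : LaurentPolynomial ℤ) ≠ 0 :=
    have := charZero_of_injective_ringHom (Polynomial.toLaurent_injective (R := ℤ))
    Nat.cast_ne_zero.2 hp.ne_zero
  have : IsNoetherianRing (LaurentPolynomial ℤ) := IsLocalization.isNoetherianRing
    (Submonoid.powers (Polynomial.X : Polynomial ℤ)) _ inferInstance
  have hpz : AddMonoidAlgebra.mapRingHom ℤ (Int.castRingHom (ZMod p))
      (p : LaurentPolynomial ℤ) = 0 := by
    rw [map_natCast]
    have h : (LaurentPolynomial.C (p : ZMod p)) = 0 := by rw [CharP.cast_eq_zero, map_zero]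
    rwa [map_natCast] at h
  obtain ⟨k, e, he, hspan⟩ := Submodule.exists_linearIndependent_modulo
    (AddMonoidAlgebra.mapRingHom ℤ (Int.castRingHom (ZMod p)))
    (mapRingHom_zmod_surjective p) (p : LaurentPolynomial ℤ) hp₀ hpz
    (exists_eq_natCast_mul_of_mapRingHom_zmod_eq_zero p) (LinearMap.ker f) (fun w hw => by
      rw [LinearMap.mem_ker, map_smul] at hw
      exact (smul_eq_zero.1 hw).resolve_left hp₀)
  have hk : k ≤ Module.finrank (LaurentPolynomial ℤ) (LinearMap.ker f) := by
    simpa using he.fintype_card_le_finrank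
  obtain ⟨x, hx⟩ := Module.Dual.exists_span_range_modulo (p : LaurentPolynomial ℤ) e he hspan
  refine ⟨fun i => if h : (i : ℕ) < k then x ⟨i, h⟩ else 0, fun ψ => ?_⟩
  obtain ⟨y, hy⟩ := hx ψ
  refine ⟨y, ?_⟩
  rw [Nat.cast_smul_eq_nsmul] at hy
  refine Submodule.span_mono ?_ hy
  rintro _ ⟨i, rfl⟩
  exact ⟨⟨i, i.2.trans_le hk⟩, by simp⟩

theorem finrank_ker_add_of_presentation {A L M : Type*} [CommRing A] [IsDomain A] [Field L]
    [Algebra A L] [IsFractionRing A L] [AddCommGroup M] [Module A M] {g r : ℕ}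
    (f : (Fin r → A) →ₗ[A] (Fin g → A)) (p : (Fin g → A) →ₗ[A] M)
    (hp : Function.Surjective p) (hexact : LinearMap.range f = LinearMap.ker p) :
    Module.finrank A (LinearMap.ker f) + g = Module.finrank L (L ⊗[A] M) + r := by
  have h₁ := Submodule.finrank_quotient_add_finrank (LinearMap.ker f)
  have h₂ := Submodule.finrank_quotient_add_finrank (LinearMap.ker p)
  have h₃ : Module.finrank L (L ⊗[A] M) = Module.finrank A M :=
    (TensorProduct.isBaseChange A M L).finrank_eq
  rw [f.quotKerEquivRange.finrank_eq] at h₁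
  rw [(p.quotKerEquivOfSurjective hp).finrank_eq, ← hexact] at h₂
  simp only [Module.finrank_fin_fun] at h₁ h₂
  omega

/-- If a `Λ`-module `M` admits an exact sequence `Λ^r → Λ^g → M → 0` and has rank
`r₀ = dim_K (K ⊗_Λ M)`, then `Ext²_Λ(M, Λ)` can be generated by `r₀ − (g − r)`
elements. -/
theorem ext2_generated_by_rank_sub_deficiency
    (M : Type) [AddCommGroup M] [Module Λ M] (g r r₀ : ℕ)
    (f : (Fin r → Λ) →ₗ[Λ] (Fin g → Λ)) (p : (Fin g → Λ) →ₗ[Λ] M)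
    (hp : Function.Surjective p) (hexact : LinearMap.range f = LinearMap.ker p)
    (hr₀ : r₀ = Module.finrank K (K ⊗[Λ] M)) :
    ∃ s : Finset (Ext2 M), Submodule.span Λ (s : Set (Ext2 M)) = ⊤ ∧
      (s.card : ℤ) ≤ (r₀ : ℤ) + (r : ℤ) - (g : ℤ) := by
  have hrank := finrank_ker_add_of_presentation (L := K) f p hp hexact
  obtain ⟨θ, hθ, hθ₀⟩ := exists_surjective_dual_ker_ext f p hp hexact (ModuleCat.of Λ Λ)
  obtain ⟨a, ha, P, hfP, hP⟩ := LaurentPolynomial.exists_nsmul_projection_ker f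
  have hkill (e : Ext2 M) : a • e = 0 := by
    obtain ⟨ψ, rfl⟩ := hθ e
    rw [← map_nsmul, ← hθ₀ (ψ ∘ₗ P.codRestrict (LinearMap.ker f) (LinearMap.congr_fun hfP))]
    congr 1
    ext v
    have : P.codRestrict (LinearMap.ker f) (LinearMap.congr_fun hfP) v = a • v :=
      Subtype.ext (hP v v.2)
    simp [this]
  obtain ⟨x, hx⟩ := exists_span_range_modulo_natCast (A := Λ) (E := Ext2 M)
    (Module.finrank Λ (LinearMap.ker f)) (fun q hq => by
      obtain ⟨x, hx⟩ := LaurentPolynomial.exists_dual_ker_span_range_modulo_prime f q hq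
      refine ⟨θ ∘ x, fun e => ?_⟩
      obtain ⟨ψ, rfl⟩ := hθ e
      obtain ⟨y, hy⟩ := hx ψ
      refine ⟨θ y, ?_⟩
      rw [← map_nsmul, ← map_sub, Set.range_comp, ← Submodule.map_span]
      exact Submodule.mem_map_of_mem hy) a ha
  classical
  refine ⟨Finset.univ.image x, ?_, ?_⟩
  · rw [Finset.coe_image, Finset.coe_univ, Set.image_univ, eq_top_iff]
    intro e _
    obtain ⟨y, hy⟩ := hx e
    rwa [hkill, sub_zero] at hy
  · have := Finset.card_image_le (s := Finset.univ) (f := x)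
    rw [Finset.card_univ, Fintype.card_fin] at this
    omega
end

section
/- Let Λ = ℤ[t, t⁻¹]. Then Ext²_Λ(Λ/⟨3, t+1⟩, Λ) is isomorphic as a Λ-module to Λ/⟨3, t+1⟩; in particular it is nontrivial, being isomorphic to ℤ/3ℤ as an abelian group. -/
open LaurentPolynomial CategoryTheory

/-- The ideal `⟨3, t+1⟩` of `Λ`. -/
noncomputable abbrev I : Ideal Λ := Ideal.span {(3 : Λ), T 1 + 1}

/-- `Ext²_Λ(Λ/⟨3, t+1⟩, Λ)`, the second Ext group in the category of
`Λ`-modules, as a `Λ`-module. -/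
noncomputable abbrev Ext2I : ModuleCat Λ :=
  ((Ext Λ (ModuleCat Λ) 2).obj (Opposite.op (ModuleCat.of Λ (Λ ⧸ I)))).obj
    (ModuleCat.of Λ Λ)

universe v u

section Resolution

open Limits ZeroObject

variable {C : Type*} [Category* C] [Abelian C] {P₀ P₁ P₂ Z : C}

/-- The objects of the chain complex `⋯ ⟶ 0 ⟶ P₂ ⟶ P₁ ⟶ P₀`. -/
noncomputable def threeTermX (P₀ P₁ P₂ : C) : ℕ → C
  | 0 => P₀
  | 1 => P₁
  | 2 => P₂
  | _ + 3 => 0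

/-- The differentials of the chain complex `⋯ ⟶ 0 ⟶ P₂ ⟶ P₁ ⟶ P₀`. -/
noncomputable def threeTermD (d₁ : P₁ ⟶ P₀) (d₂ : P₂ ⟶ P₁) :
    ∀ n, threeTermX P₀ P₁ P₂ (n + 1) ⟶ threeTermX P₀ P₁ P₂ n
  | 0 => d₁
  | 1 => d₂
  | _ + 2 => 0

/-- The chain complex `⋯ ⟶ 0 ⟶ P₂ ⟶ P₁ ⟶ P₀`. -/
noncomputable def threeTermComplex (d₁ : P₁ ⟶ P₀) (d₂ : P₂ ⟶ P₁) (w : d₂ ≫ d₁ = 0) :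
    ChainComplex C ℕ :=
  ChainComplex.of (threeTermX P₀ P₁ P₂) (threeTermD d₁ d₂) fun
    | 0 => w
    | _ + 1 => zero_comp

lemma threeTermComplex_d (d₁ : P₁ ⟶ P₀) (d₂ : P₂ ⟶ P₁) (w : d₂ ≫ d₁ = 0) (n : ℕ) :
    (threeTermComplex d₁ d₂ w).d (n + 1) n = threeTermD d₁ d₂ n :=
  ChainComplex.of_d _ _ _

lemma isZero_threeTermComplex_X (d₁ : P₁ ⟶ P₀) (d₂ : P₂ ⟶ P₁) (w : d₂ ≫ d₁ = 0) (n : ℕ) :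
    IsZero ((threeTermComplex d₁ d₂ w).X (n + 3)) :=
  isZero_zero C

lemma threeTermComplex_exactAt_succ (d₁ : P₁ ⟶ P₀) (d₂ : P₂ ⟶ P₁) (w : d₂ ≫ d₁ = 0)
    [Mono d₂] (h : (ShortComplex.mk d₂ d₁ w).Exact) (n : ℕ) :
    (threeTermComplex d₁ d₂ w).ExactAt (n + 1) := by
  rw [HomologicalComplex.exactAt_iff' _ (n + 1 + 1) (n + 1) n (by simp) (by simp)]
  match n with
  | 0 =>
    have e : ShortComplex.mk d₂ d₁ w ≅ (threeTermComplex d₁ d₂ w).sc' 2 1 0 :=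
      ShortComplex.isoMk (Iso.refl P₂) (Iso.refl P₁) (Iso.refl P₀)
        ((Category.id_comp _).trans
          ((threeTermComplex_d d₁ d₂ w 1).trans (Category.comp_id d₂).symm))
        ((Category.id_comp _).trans
          ((threeTermComplex_d d₁ d₂ w 0).trans (Category.comp_id d₁).symm))
    exact ShortComplex.exact_of_iso e h
  | 1 =>
    refine (ShortComplex.exact_iff_mono _ ?_).2 ?_
    · exact (isZero_threeTermComplex_X d₁ d₂ w 0).eq_of_src _ _
    · have hd : Mono ((threeTermComplex d₁ d₂ w).d (1 + 1) 1) := by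
        rw [threeTermComplex_d]
        exact ‹Mono d₂›
      exact hd
  | n + 2 => exact ShortComplex.exact_of_isZero_X₂ _ (isZero_threeTermComplex_X d₁ d₂ w n)

/-- The projective resolution given by an exact sequence `0 ⟶ P₂ ⟶ P₁ ⟶ P₀ ⟶ Z ⟶ 0` with
`P₀`, `P₁` and `P₂` projective. -/
noncomputable def threeTermResolution [Projective P₀] [Projective P₁] [Projective P₂]
    (d₁ : P₁ ⟶ P₀) (d₂ : P₂ ⟶ P₁) (w : d₂ ≫ d₁ = 0) (ε : P₀ ⟶ Z) (w' : d₁ ≫ ε = 0)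
    [Mono d₂] (h : (ShortComplex.mk d₂ d₁ w).Exact) (h' : (ShortComplex.mk d₁ ε w').Exact)
    [Epi ε] : ProjectiveResolution Z where
  complex := threeTermComplex d₁ d₂ w
  projective
    | 0 => ‹Projective P₀›
    | 1 => ‹Projective P₁›
    | 2 => ‹Projective P₂›
    | _ + 3 => (isZero_threeTermComplex_X d₁ d₂ w _).projective
  π := (ChainComplex.toSingle₀Equiv _ _).symm
    ⟨ε, (congrArg (· ≫ ε) (threeTermComplex_d d₁ d₂ w 0)).trans w'⟩
  quasiIso := ⟨fun n => by
    cases n with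
    | zero =>
      rw [ChainComplex.quasiIsoAt₀_iff, ShortComplex.quasiIso_iff_of_zeros' _ rfl rfl rfl]
      refine (ShortComplex.exact_and_epi_g_iff_of_iso ?_).1 ⟨h', ‹Epi ε›⟩
      refine ShortComplex.isoMk (Iso.refl P₁) (Iso.refl P₀) (Iso.refl Z)
        ((Category.id_comp _).trans
          ((threeTermComplex_d d₁ d₂ w 0).trans (Category.comp_id d₁).symm)) ?_
      refine (Category.id_comp _).trans (Eq.trans ?_ (Category.comp_id ε).symm)
      exact ChainComplex.toSingle₀Equiv_symm_apply_f_zero (C := threeTermComplex d₁ d₂ w) ε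
        ((congrArg (· ≫ ε) (threeTermComplex_d d₁ d₂ w 0)).trans w')
    | succ n =>
      rw [quasiIsoAt_iff_exactAt' _ _ (ChainComplex.exactAt_succ_single_obj _ _)]
      exact threeTermComplex_exactAt_succ d₁ d₂ w h n⟩

/-- If `X₂ ⟶ X₃` vanishes, the homology at `X₂` is any cokernel of `X₁ ⟶ X₂`. -/
lemma CategoryTheory.ShortComplex.nonempty_homology_iso_of_exact (S : ShortComplex C) (hg : S.g = 0)
    {Q : C} (p : S.X₂ ⟶ Q) (hp : Epi p) (w : S.f ≫ p = 0) (h : (ShortComplex.mk S.f p w).Exact) :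
    Nonempty (S.homology ≅ Q) :=
  have := S.isIso_homologyι hg
  ⟨asIso S.homologyι ≪≫ S.opcyclesIsCokernel.coconePointUniqueUpToIso h.gIsCokernel⟩

lemma exists_projectiveResolution [Projective P₀] [Projective P₁] [Projective P₂]
    (d₁ : P₁ ⟶ P₀) (d₂ : P₂ ⟶ P₁) (w : d₂ ≫ d₁ = 0) (ε : P₀ ⟶ Z) (w' : d₁ ≫ ε = 0)
    [Mono d₂] (h : (ShortComplex.mk d₂ d₁ w).Exact) (h' : (ShortComplex.mk d₁ ε w').Exact)
    [Epi ε] : ∃ (P : ProjectiveResolution Z) (e₁ : P.complex.X 1 ≅ P₁) (e₂ : P.complex.X 2 ≅ P₂),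
      P.complex.d 2 1 ≫ e₁.hom = e₂.hom ≫ d₂ ∧ IsZero (P.complex.X 3) :=
  ⟨threeTermResolution d₁ d₂ w ε w' h h', Iso.refl P₁, Iso.refl P₂,
    (Category.comp_id _).trans ((threeTermComplex_d d₁ d₂ w 1).trans (Category.id_comp d₂).symm),
    isZero_threeTermComplex_X d₁ d₂ w 0⟩

/-- If `P` is a projective resolution of `Z` with `P₃ = 0`, then `Ext²(Z, Y)` is any
cokernel of `Hom(P₁, Y) → Hom(P₂, Y)`. -/
lemma CategoryTheory.ProjectiveResolution.nonempty_ext_two_linearEquiv_of_exact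
    {R : Type*} [Ring R] {C : Type*} [Category.{v} C] [Abelian C] [Linear R C]
    [EnoughProjectives C] {Z : C} (P : ProjectiveResolution Z) (hP : IsZero (P.complex.X 3))
    (Y : C) {Q : Type v} [AddCommGroup Q] [Module R Q] (p : (P.complex.X 2 ⟶ Y) →ₗ[R] Q)
    (hp : Function.Surjective p)
    (hdp : Function.Exact (fun f : P.complex.X 1 ⟶ Y => P.complex.d 2 1 ≫ f) p) :
    Nonempty (((Ext R C 2).obj (Opposite.op Z)).obj Y ≃ₗ[R] Q) := by
  let K := P.complex.linearYonedaObj R Y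
  let q : K.X 2 ⟶ ModuleCat.of R Q := ModuleCat.ofHom p
  have hq : Function.Exact (K.d 1 2).hom q.hom := hdp
  have : Epi q := (ModuleCat.epi_iff_surjective _).2 hp
  obtain ⟨e⟩ := ShortComplex.nonempty_homology_iso_of_exact (K.sc' 1 2 3)
    (ModuleCat.hom_ext (LinearMap.ext fun f => hP.eq_of_src _ _)) q this
    (ModuleCat.hom_ext hq.linearMap_comp_eq_zero) (ModuleCat.shortComplex_exact _ hq)
  exact ⟨(P.isoExt 2 Y ≪≫ K.homologyIsoSc' 1 2 3 (by simp) (by simp) ≪≫ e).toLinearEquiv⟩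

/-- If `0 ⟶ P₂ ⟶ P₁ ⟶ P₀ ⟶ Z ⟶ 0` is exact with `P₀`, `P₁` and `P₂` projective, then
`Ext²(Z, Y)` is any cokernel of `Hom(P₁, Y) → Hom(P₂, Y)`. -/
theorem nonempty_ext_two_linearEquiv_of_exact {R : Type*} [Ring R] {C : Type*} [Category.{v} C]
    [Abelian C] [Linear R C] [EnoughProjectives C] {P₀ P₁ P₂ Z : C}
    [Projective P₀] [Projective P₁] [Projective P₂]
    (d₁ : P₁ ⟶ P₀) (d₂ : P₂ ⟶ P₁) (w : d₂ ≫ d₁ = 0) (ε : P₀ ⟶ Z) (w' : d₁ ≫ ε = 0)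
    [Mono d₂] (h : (ShortComplex.mk d₂ d₁ w).Exact) (h' : (ShortComplex.mk d₁ ε w').Exact)
    [Epi ε] (Y : C) {Q : Type v} [AddCommGroup Q] [Module R Q] (p : (P₂ ⟶ Y) →ₗ[R] Q)
    (hp : Function.Surjective p) (hdp : Function.Exact (fun f : P₁ ⟶ Y => d₂ ≫ f) p) :
    Nonempty (((Ext R C 2).obj (Opposite.op Z)).obj Y ≃ₗ[R] Q) := by
  obtain ⟨P, e₁, e₂, hd, hP⟩ := exists_projectiveResolution d₁ d₂ w ε w' h h'
  refine P.nonempty_ext_two_linearEquiv_of_exact hP Y (p ∘ₗ Linear.leftComp R Y e₂.inv)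
    (fun x => ?_) fun f => ?_
  · obtain ⟨f, rfl⟩ := hp x
    exact ⟨e₂.hom ≫ f, by simp⟩
  · refine (hdp (e₂.inv ≫ f)).trans ⟨?_, ?_⟩
    · rintro ⟨g, hg⟩
      refine ⟨e₁.hom ≫ g, ?_⟩
      dsimp only at hg ⊢
      rw [← Category.assoc, hd, Category.assoc, hg, Iso.hom_inv_id_assoc]
    · rintro ⟨g, rfl⟩
      refine ⟨e₁.inv ≫ g, ?_⟩
      have hd' : d₂ ≫ e₁.inv = e₂.inv ≫ P.complex.d 2 1 := by
        rw [Iso.comp_inv_eq, Category.assoc, hd, Iso.inv_hom_id_assoc]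
      simpa only [Category.assoc] using congrArg (· ≫ g) hd'

end Resolution

section RegularPair

variable {R : Type u} [CommRing R]

/-- The map `R² → R`, `(x, y) ↦ a x + b y`. -/
def koszulD₁ (a b : R) : R × R →ₗ[R] R :=
  (LinearMap.mulLeft R a).coprod (LinearMap.mulLeft R b)

/-- The map `R → R²`, `r ↦ (b r, -a r)`. -/
def koszulD₂ (a b : R) : R →ₗ[R] R × R :=
  (LinearMap.mulLeft R b).prod (-LinearMap.mulLeft R a)

@[simp]
lemma koszulD₁_apply (a b : R) (x : R × R) : koszulD₁ a b x = a * x.1 + b * x.2 := rfl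

@[simp]
lemma koszulD₂_apply (a b r : R) : koszulD₂ a b r = (b * r, -(a * r)) := rfl

lemma koszulD₂_exact_koszulD₁ {a b : R} (hb : IsLeftRegular b) (hab : ∀ x, b ∣ a * x → b ∣ x) :
    Function.Exact (koszulD₂ a b) (koszulD₁ a b) := by
  rintro ⟨x, y⟩
  constructor
  · intro h
    replace h : a * x + b * y = 0 := h
    obtain ⟨r, rfl⟩ := hab x ⟨-y, by linear_combination h⟩
    exact ⟨r, Prod.ext rfl (hb (by simp only [koszulD₂_apply]; linear_combination -h))⟩
  · rintro ⟨r, h⟩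
    rw [← h]
    simp only [koszulD₁_apply, koszulD₂_apply]
    ring

lemma koszulD₁_exact_mkQ (a b : R) :
    Function.Exact (koszulD₁ a b) (Ideal.span {a, b}).mkQ := by
  intro x
  simp only [Submodule.mkQ_apply, Submodule.Quotient.mk_eq_zero, Ideal.mem_span_pair,
    Set.mem_range, Prod.exists, koszulD₁_apply, mul_comm]

/-- The dual of the top Koszul differential has cokernel `R ⧸ (a, b)`, via `f ↦ [f 1]`. -/
lemma koszul_dual_exact (a b : R) :
    Function.Exact (fun f : R × R →ₗ[R] R => f ∘ₗ koszulD₂ a b)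
      (fun f : R →ₗ[R] R => (Ideal.span {a, b}).mkQ (f 1)) := by
  intro f
  simp only [Submodule.mkQ_apply, Submodule.Quotient.mk_eq_zero, Ideal.mem_span_pair,
    Set.mem_range]
  constructor
  · rintro ⟨x, y, h⟩
    refine ⟨koszulD₁ y (-x), LinearMap.ext_ring ?_⟩
    simp only [LinearMap.comp_apply, koszulD₂_apply, koszulD₁_apply]
    linear_combination h
  · rintro ⟨g, rfl⟩
    refine ⟨-g (0, 1), g (1, 0), ?_⟩
    have h : koszulD₂ a b 1 = b • (1, 0) + (-a) • (0, 1) := by simp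
    rw [LinearMap.comp_apply, h, map_add, map_smul, map_smul, smul_eq_mul, smul_eq_mul]
    ring

/-- If `b` is regular and `a` is regular modulo `b`, then `Ext²(R ⧸ (a, b), R) ≃ R ⧸ (a, b)`. -/
theorem nonempty_ext_two_linearEquiv {a b : R} (hb : IsLeftRegular b)
    (hab : ∀ x, b ∣ a * x → b ∣ x) :
    Nonempty (((Ext R (ModuleCat R) 2).obj
      (Opposite.op (ModuleCat.of R (R ⧸ Ideal.span {a, b})))).obj (ModuleCat.of R R) ≃ₗ[R]
        (R ⧸ Ideal.span {a, b})) := by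
  have : Mono (ModuleCat.ofHom (koszulD₂ a b)) :=
    (ModuleCat.mono_iff_injective _).2 fun _ _ h => hb (congrArg Prod.fst h)
  have : Epi (ModuleCat.ofHom (Ideal.span {a, b}).mkQ) :=
    (ModuleCat.epi_iff_surjective _).2 (Submodule.mkQ_surjective _)
  refine nonempty_ext_two_linearEquiv_of_exact
    (ModuleCat.ofHom (koszulD₁ a b)) (ModuleCat.ofHom (koszulD₂ a b))
    (ModuleCat.hom_ext (koszulD₂_exact_koszulD₁ hb hab).linearMap_comp_eq_zero)
    (ModuleCat.ofHom (Ideal.span {a, b}).mkQ)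
    (ModuleCat.hom_ext (koszulD₁_exact_mkQ a b).linearMap_comp_eq_zero)
    (ModuleCat.shortComplex_exact _ (koszulD₂_exact_koszulD₁ hb hab))
    (ModuleCat.shortComplex_exact _ (koszulD₁_exact_mkQ a b)) (ModuleCat.of R R)
    ((Ideal.span {a, b}).mkQ ∘ₗ LinearMap.applyₗ (1 : R) ∘ₗ
      (ModuleCat.homLinearEquiv (S := R) (M := ModuleCat.of R R)
        (N := ModuleCat.of R R)).toLinearMap) (fun y => ?_) fun f => ?_
  · obtain ⟨x, rfl⟩ := Submodule.mkQ_surjective _ y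
    exact ⟨ModuleCat.ofHom (LinearMap.mulLeft R x),
      congrArg (Ideal.span {a, b}).mkQ (mul_one x)⟩
  · refine (koszul_dual_exact a b f.hom).trans ⟨?_, ?_⟩
    · rintro ⟨g, hg⟩
      exact ⟨ModuleCat.ofHom g, ModuleCat.hom_ext hg⟩
    · rintro ⟨g, hg⟩
      exact ⟨g.hom, congrArg ModuleCat.Hom.hom hg⟩

end RegularPair

section Laurent

/-- Evaluation of integral Laurent polynomials at `-1`. -/
noncomputable def evalNegOne : Λ →+* ℤ := LaurentPolynomial.eval₂ (RingHom.id ℤ) (-1)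

lemma evalNegOne_T_one : evalNegOne (T 1) = -1 := by
  simp [evalNegOne]

lemma evalNegOne_T_add_one : evalNegOne (T 1 + 1) = 0 := by
  rw [map_add, evalNegOne_T_one, map_one, neg_add_cancel]

lemma T_add_one_dvd_sub_evalNegOne (f : Λ) : (T 1 + 1 : Λ) ∣ f - (evalNegOne f : Λ) := by
  have h : Ideal.Quotient.mk (Ideal.span {(T 1 + 1 : Λ)}) =
      (Int.castRingHom (Λ ⧸ Ideal.span {(T 1 + 1 : Λ)})).comp evalNegOne := by
    refine IsLocalization.ringHom_ext (Submonoid.powers (Polynomial.X : Polynomial ℤ))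
      (Polynomial.ringHom_ext' (Subsingleton.elim _ _) ?_)
    simp only [RingHom.comp_apply, algebraMap_eq_toLaurent, Polynomial.toLaurent_X,
      evalNegOne_T_one]
    rw [eq_intCast, Int.cast_neg, Int.cast_one, eq_neg_iff_add_eq_zero,
      ← map_one (Ideal.Quotient.mk _), ← map_add, Ideal.Quotient.eq_zero_iff_mem]
    exact Ideal.mem_span_singleton_self _
  rw [← Ideal.mem_span_singleton, ← Ideal.Quotient.eq_zero_iff_mem, map_sub, map_intCast,
    congrArg (· f) h, RingHom.comp_apply, eq_intCast, sub_self]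

lemma T_add_one_dvd_iff (f : Λ) : (T 1 + 1 : Λ) ∣ f ↔ evalNegOne f = 0 := by
  refine ⟨?_, fun h => by simpa [h] using T_add_one_dvd_sub_evalNegOne f⟩
  rintro ⟨g, rfl⟩
  rw [map_mul, evalNegOne_T_add_one, zero_mul]

lemma ker_castRingHom_comp_evalNegOne :
    RingHom.ker ((Int.castRingHom (ZMod 3)).comp evalNegOne) = I := by
  ext f
  rw [RingHom.mem_ker, RingHom.comp_apply, eq_intCast, ZMod.intCast_zmod_eq_zero_iff_dvd,
    Ideal.mem_span_pair]
  constructor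
  · rintro ⟨n, hn⟩
    obtain ⟨g, hg⟩ := T_add_one_dvd_sub_evalNegOne f
    refine ⟨n, g, ?_⟩
    rw [hn] at hg
    push_cast at hg
    linear_combination -hg
  · rintro ⟨g, h, rfl⟩
    refine ⟨evalNegOne g, ?_⟩
    rw [map_add, map_mul, map_mul, evalNegOne_T_add_one, map_ofNat]
    push_cast
    ring

end Laurent

/-- `Ext²_Λ(Λ/⟨3, t+1⟩, Λ)` is isomorphic as a `Λ`-module to `Λ/⟨3, t+1⟩`;
in particular it is isomorphic to `ℤ/3ℤ` as an abelian group, hence nontrivial. -/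
theorem ext2_of_quotient :
    Nonempty (Ext2I ≃ₗ[Λ] (Λ ⧸ I)) ∧ Nonempty (Ext2I ≃+ ZMod 3) ∧
      ¬ Subsingleton Ext2I := by
  have hne : (T 1 + 1 : Λ) ≠ 0 := fun h => by
    have h' := congrArg (LaurentPolynomial.eval₂ (RingHom.id ℤ) 1) h
    simp at h'
  obtain ⟨e⟩ := nonempty_ext_two_linearEquiv (a := (3 : Λ)) (b := T 1 + 1)
    (IsLeftCancelMulZero.mul_left_cancel_of_ne_zero hne) fun f hf => by
      rw [T_add_one_dvd_iff, map_mul, map_ofNat] at hf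
      exact (T_add_one_dvd_iff f).2 (by simpa using hf)
  let e' : Ext2I ≃+ ZMod 3 := e.toAddEquiv.trans
    ((Ideal.quotEquivOfEq ker_castRingHom_comp_evalNegOne.symm).trans
      (RingHom.quotientKerEquivOfSurjective (ZMod.ringHom_surjective _))).toAddEquiv
  exact ⟨⟨e⟩, ⟨e'⟩, fun _ => not_subsingleton (ZMod 3) e'.symm.injective.subsingleton⟩
end

section
/- Let Λ = ℤ[t, t⁻¹]. The Λ-module Λ/⟨3, t+1⟩ has deficiency exactly −1: every exact sequence of Λ-modules Λ^r → Λ^g → Λ/⟨3, t+1⟩ → 0 satisfies g − r ≤ −1, and there exists such an exact sequence with g = 1 and r = 2. -/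
open LaurentPolynomial

theorem I_ne_top : I ≠ ⊤ := by
  let φ : Λ →+* ZMod 3 := eval₂ (Int.castRingHom (ZMod 3)) (-1)
  have hle : I ≤ RingHom.ker φ := by
    rw [Ideal.span_le]
    rintro x (rfl | rfl)
    · exact (map_ofNat φ 3).trans rfl
    · simp [RingHom.mem_ker, φ, eval₂_T]
  exact fun h => RingHom.ker_ne_top φ (top_le_iff.mp (h ▸ hle))

theorem prime_three_laurent : Prime (3 : Λ) := by
  have h3 : Prime (3 : Polynomial ℤ) := by
    simpa using Polynomial.prime_C_iff.mpr Int.prime_three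
  have hmap : IsLocalization.toLocalizationMap
      (Submonoid.powers (Polynomial.X : Polynomial ℤ)) Λ 3 = 3 :=
    map_ofNat (algebraMap (Polynomial ℤ) Λ) 3
  rw [← hmap]
  refine Submonoid.LocalizationMap.map_prime _ h3 ?_ ?_
  · exact Polynomial.toLaurent_ne_zero.mpr h3.ne_zero
  · rw [hmap]
    exact fun hu => I_ne_top
      (Ideal.eq_top_of_isUnit_mem _ (Ideal.subset_span (Set.mem_insert _ _)) hu)

theorem not_three_dvd_T_one_add_one : ¬ (3 : Λ) ∣ T 1 + 1 := by
  let φ : Λ →+* ZMod 3 := eval₂ (Int.castRingHom (ZMod 3)) 1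
  intro h
  have h' := map_dvd φ h
  have h3 : (3 : ZMod 3) = 0 := rfl
  have h2 : (1 + 1 : ZMod 3) ≠ 0 := by decide
  rw [map_ofNat, h3, zero_dvd_iff] at h'
  exact h2 (by simpa [φ, eval₂_T] using h')

theorem isUnit_of_dvd_three_pow_of_dvd_T_one_add_one_pow {d : Λ} {m n : ℕ}
    (h3 : d ∣ 3 ^ m) (ht : d ∣ (T 1 + 1) ^ n) : IsUnit d := by
  obtain ⟨k, -, hk⟩ := (dvd_prime_pow prime_three_laurent m).mp h3
  rcases Nat.eq_zero_or_pos k with rfl | hpos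
  · exact hk.isUnit_iff.mpr (by simp)
  · have h : (3 : Λ) ∣ (T 1 + 1) ^ n :=
      (dvd_pow_self 3 hpos.ne').trans (hk.symm.dvd.trans ht)
    exact absurd (prime_three_laurent.dvd_of_dvd_pow h) not_three_dvd_T_one_add_one

/-- If a scalar `a` kills the cokernel of an endomorphism `f` of a free module, then
`det f` divides a power of `a`. -/
theorem LinearMap.det_dvd_pow_finrank_of_smul_mem_range {R M : Type*} [CommRing R]
    [AddCommGroup M] [Module R M] [Module.Free R M]
    (f : M →ₗ[R] M) (a : R) (h : ∀ x, a • x ∈ LinearMap.range f) :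
    LinearMap.det f ∣ a ^ Module.finrank R M := by
  obtain ⟨b, hb⟩ := Module.projective_lifting_property f.rangeRestrict
    ((a • (LinearMap.id : M →ₗ[R] M)).codRestrict (LinearMap.range f) h)
    f.surjective_rangeRestrict
  have hfb : f ∘ₗ b = a • LinearMap.id :=
    LinearMap.ext fun x => congrArg Subtype.val (LinearMap.congr_fun hb x)
  exact ⟨LinearMap.det b, by
    rw [← LinearMap.det_comp, hfb, LinearMap.det_smul, LinearMap.det_id, mul_one]⟩

theorem smul_mem_ker_of_mem_I {M : Type*} [AddCommGroup M] [Module Λ M]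
    (p : M →ₗ[Λ] (Λ ⧸ I)) {a : Λ} (ha : a ∈ I) (x : M) : a • x ∈ LinearMap.ker p := by
  rw [LinearMap.mem_ker, map_smul]
  obtain ⟨y, hy⟩ := Submodule.Quotient.mk_surjective I (p x)
  rw [← hy, ← Submodule.Quotient.mk_smul, Submodule.Quotient.mk_eq_zero]
  exact I.mul_mem_right y ha

theorem range_ne_ker_of_surjective {g : ℕ} (f : (Fin g → Λ) →ₗ[Λ] (Fin g → Λ))
    (p : (Fin g → Λ) →ₗ[Λ] (Λ ⧸ I)) (hp : Function.Surjective p) :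
    LinearMap.range f ≠ LinearMap.ker p := by
  intro hfp
  have hdvd : ∀ a ∈ I, LinearMap.det f ∣ a ^ Module.finrank Λ (Fin g → Λ) := fun a ha =>
    f.det_dvd_pow_finrank_of_smul_mem_range a fun x => hfp ▸ smul_mem_ker_of_mem_I p ha x
  have hunit : IsUnit (LinearMap.det f) :=
    isUnit_of_dvd_three_pow_of_dvd_T_one_add_one_pow
      (hdvd 3 (Ideal.subset_span (by simp))) (hdvd (T 1 + 1) (Ideal.subset_span (by simp)))
  have hrange : LinearMap.range f = ⊤ :=
    LinearMap.range_eq_top.mpr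
      ((Module.End.isUnit_iff f).mp ((LinearMap.isUnit_iff_isUnit_det f).mpr hunit)).2
  have : Nontrivial (Λ ⧸ I) := Submodule.Quotient.nontrivial_iff.mpr I_ne_top
  obtain ⟨y, hy⟩ := exists_ne (0 : Λ ⧸ I)
  obtain ⟨x, rfl⟩ := hp y
  have hx : x ∈ LinearMap.ker p := hfp ▸ hrange ▸ Submodule.mem_top
  exact hy hx

/-- The `Λ`-module `Λ/⟨3, t+1⟩` has deficiency exactly `−1`: every exact
sequence `Λ^r → Λ^g → Λ/⟨3, t+1⟩ → 0` satisfies `g − r ≤ −1`, and there is such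
an exact sequence with `g = 1` and `r = 2`. -/
theorem deficiency_of_quotient_eq_neg_one :
    (∀ (g r : ℕ) (f : (Fin r → Λ) →ₗ[Λ] (Fin g → Λ))
        (p : (Fin g → Λ) →ₗ[Λ] (Λ ⧸ I)),
        Function.Surjective p → LinearMap.range f = LinearMap.ker p →
        (g : ℤ) - (r : ℤ) ≤ -1) ∧
      (∃ (f : (Fin 2 → Λ) →ₗ[Λ] (Fin 1 → Λ)) (p : (Fin 1 → Λ) →ₗ[Λ] (Λ ⧸ I)),
        Function.Surjective p ∧ LinearMap.range f = LinearMap.ker p) := by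
  refine ⟨fun g r f p hp hfp => ?_, ?_⟩
  · by_contra hlt
    have hle : r ≤ g := by omega
    refine range_ne_ker_of_surjective (f ∘ₗ LinearMap.funLeft Λ Λ (Fin.castLE hle)) p hp ?_
    rw [LinearMap.range_comp_of_range_eq_top _ (LinearMap.range_eq_top.mpr
      (LinearMap.funLeft_surjective_of_injective Λ Λ _ (Fin.castLE_injective hle))), hfp]
  · refine ⟨LinearMap.pi fun _ =>
        (3 : Λ) • LinearMap.proj (0 : Fin 2) + (T 1 + 1 : Λ) • LinearMap.proj (1 : Fin 2),
      I.mkQ ∘ₗ LinearMap.proj (0 : Fin 1),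
      I.mkQ_surjective.comp (LinearMap.proj_surjective 0), ?_⟩
    ext x
    simp only [LinearMap.mem_range, LinearMap.mem_ker, LinearMap.comp_apply, LinearMap.proj_apply,
      Submodule.mkQ_apply, Submodule.Quotient.mk_eq_zero, Ideal.mem_span_pair]
    constructor
    · rintro ⟨y, rfl⟩
      exact ⟨y 0, y 1, by simp [mul_comm]⟩
    · rintro ⟨a, b, h⟩
      refine ⟨![a, b], funext fun i => ?_⟩
      rw [Subsingleton.elim i 0, ← h]
      simp [mul_comm]
end

section
/- For every natural number N there exists a finitely presented group G such that G is perfect (trivial abelianization), the second group homology H₂(G; ℤ) with trivial integer coefficients vanishes, and every finite presentation of G with g generators and r relations satisfies g − r < −N; that is, there exist finitely presented perfect groups G with H₂(G) = 0 of arbitrarily large negative deficiency. -/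
/-- Vanishing of the second group homology `H₂(G; ℤ)` with trivial integer
coefficients, expressed via Hopf's formula: for any free presentation
`G = F/R` one has `H₂(G; ℤ) ≅ (R ∩ [F, F]) / [F, R]`, so `H₂(G; ℤ) = 0` iff
`R ∩ [F, F] ≤ [F, R]` for every surjection `π : F → G` from a free group. -/
def H2Trivial (G : Type) [Group G] : Prop :=
  ∀ (α : Type) (π : FreeGroup α →* G), Function.Surjective π →
    MonoidHom.ker π ⊓ commutator (FreeGroup α) ≤
      ⁅(⊤ : Subgroup (FreeGroup α)), MonoidHom.ker π⁆

open scoped commutatorElement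

/-! ### Central extensions -/

/-- Two homomorphisms that differ by central elements agree on the commutator subgroup. -/
theorem MonoidHom.eqOn_commutator_of_mul_inv_mem_center {H E : Type*} [Group H] [Group E]
    (f g : H →* E) (h : ∀ x, f x * (g x)⁻¹ ∈ Subgroup.center E) {w : H}
    (hw : w ∈ commutator H) : f w = g w := by
  let d : H →* ↥(Subgroup.center E) := MonoidHom.mk' (fun x => ⟨f x * (g x)⁻¹, h x⟩) fun x y => by
    ext
    have hy := Subgroup.mem_center_iff.1 (h y) (g x)⁻¹
    simp only [map_mul, mul_inv_rev, Subgroup.coe_mul]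
    calc f x * f y * ((g y)⁻¹ * (g x)⁻¹) = f x * (f y * (g y)⁻¹ * (g x)⁻¹) := by group
      _ = f x * (g x)⁻¹ * (f y * (g y)⁻¹) := by rw [← hy]; group
  have hd : d w = 1 := by
    have hle : commutator H ≤ d.ker := Subgroup.commutator_le.2 fun x _ y _ => by
      rw [MonoidHom.mem_ker, map_commutatorElement, commutatorElement_eq_one_iff_mul_comm]
      exact Subtype.ext (Subgroup.mem_center_iff.1 (d y).2 (d x))
    exact hle hw
  exact mul_inv_eq_one.1 (congrArg Subtype.val hd)

/-- A group all of whose central extensions split has trivial second homology. -/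
theorem H2Trivial.of_central_extension_splits {G : Type} [Group G]
    (hG : ∀ (E : Type) [Group E] (q : E →* G), Function.Surjective q →
      q.ker ≤ Subgroup.center E → ∃ s : G →* E, ∀ x, q (s x) = x) : H2Trivial G := by
  intro α π hπ x hx
  have hN : ⁅(⊤ : Subgroup (FreeGroup α)), π.ker⁆ ≤ π.ker := Subgroup.commutator_le_right _ _
  let q : FreeGroup α ⧸ ⁅(⊤ : Subgroup (FreeGroup α)), π.ker⁆ →* G := QuotientGroup.lift _ π hN
  have hq : q.ker ≤ Subgroup.center _ := by
    intro e he
    obtain ⟨k, rfl⟩ := QuotientGroup.mk_surjective e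
    rw [Subgroup.mem_center_iff]
    intro e'
    obtain ⟨y, rfl⟩ := QuotientGroup.mk_surjective e'
    have hyk : ⁅y, k⁆ ∈ ⁅(⊤ : Subgroup (FreeGroup α)), π.ker⁆ :=
      Subgroup.commutator_mem_commutator (Subgroup.mem_top y) he
    have h1 := (QuotientGroup.eq_one_iff _).2 hyk
    rw [commutatorElement_def] at h1
    simp only [QuotientGroup.mk_mul, QuotientGroup.mk_inv] at h1
    rw [mul_inv_eq_one, mul_inv_eq_iff_eq_mul] at h1
    exact h1
  obtain ⟨s, hs⟩ := hG _ q (fun g => (hπ g).imp' QuotientGroup.mk fun a ha => ha) hq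
  have key := MonoidHom.eqOn_commutator_of_mul_inv_mem_center (QuotientGroup.mk' _) (s.comp π)
    (fun y => hq (by
      rw [MonoidHom.mem_ker, map_mul, map_inv, MonoidHom.comp_apply, hs]
      exact mul_inv_cancel _)) hx.2
  rw [MonoidHom.comp_apply, MonoidHom.mem_ker.1 hx.1, map_one] at key
  exact (QuotientGroup.eq_one_iff _).1 key

/-! ### Universal central extensions of perfect groups -/

/-- Relators making the relators `R` central and identifying each generator `i` with `w i`. -/
def coverRelators {α : Type} (R : Set (FreeGroup α)) (w : α → FreeGroup α) :
    Set (FreeGroup α) :=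
  Set.image2 (fun (i : α) (r : FreeGroup α) => ⁅FreeGroup.of i, r⁆) Set.univ R ∪
    Set.range fun i => FreeGroup.of i * (w i)⁻¹

/-- The group `⟨x_i ∣ [x_i, r] = 1, x_i = w_i⟩`. If `⟨x_i ∣ R⟩` is perfect and `w_i` is a product
of commutators representing `x_i`, then this is its universal central extension. -/
abbrev CoverGroup {α : Type} (R : Set (FreeGroup α)) (w : α → FreeGroup α) : Type :=
  PresentedGroup (coverRelators R w)

namespace CoverGroup

variable {α : Type} {R : Set (FreeGroup α)} {w : α → FreeGroup α}

theorem mk_generator (i : α) :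
    PresentedGroup.mk (coverRelators R w) (FreeGroup.of i) = PresentedGroup.mk _ (w i) := by
  rw [← mul_inv_eq_one, ← map_inv, ← map_mul]
  exact PresentedGroup.one_of_mem (Or.inr ⟨i, rfl⟩)

theorem mk_relator_mem_center {r : FreeGroup α} (hr : r ∈ R) :
    PresentedGroup.mk (coverRelators R w) r ∈ Subgroup.center (CoverGroup R w) := by
  have h : (PresentedGroup.mk (coverRelators R w)) =
      ((MulAut.conj (PresentedGroup.mk (coverRelators R w) r)).toMonoidHom.comp
        (PresentedGroup.mk (coverRelators R w))) := by
    ext i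
    have h1 : PresentedGroup.mk (coverRelators R w) ⁅FreeGroup.of i, r⁆ = 1 :=
      PresentedGroup.one_of_mem (Or.inl ⟨i, Set.mem_univ i, r, hr, rfl⟩)
    rw [map_commutatorElement, commutatorElement_eq_one_iff_mul_comm] at h1
    simp only [MonoidHom.comp_apply, MulEquiv.coe_toMonoidHom, MulAut.conj_apply]
    rw [← h1, mul_inv_cancel_right]
  rw [Subgroup.mem_center_iff]
  intro g
  obtain ⟨x, rfl⟩ := PresentedGroup.mk_surjective _ g
  have hx := DFunLike.congr_fun h x
  simp only [MonoidHom.comp_apply, MulEquiv.coe_toMonoidHom, MulAut.conj_apply] at hx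
  exact eq_mul_inv_iff_mul_eq.1 hx

theorem commutator_eq_top (hw : ∀ i, w i ∈ commutator (FreeGroup α)) :
    commutator (CoverGroup R w) = ⊤ := by
  rw [eq_top_iff, ← PresentedGroup.closure_range_of, Subgroup.closure_le]
  rintro _ ⟨i, rfl⟩
  have h := Subgroup.mem_map_of_mem (PresentedGroup.mk (coverRelators R w)) (hw i)
  rw [← mk_generator] at h
  rw [commutator_def, Subgroup.map_commutator] at h
  exact Subgroup.commutator_mono le_top le_top h

theorem exists_splitting (hw : ∀ i, w i ∈ commutator (FreeGroup α)) {E : Type} [Group E]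
    (q : E →* CoverGroup R w) (hq : Function.Surjective q) (hqc : q.ker ≤ Subgroup.center E) :
    ∃ s : CoverGroup R w →* E, ∀ x, q (s x) = x := by
  choose σ hσ using hq
  let y₀ : FreeGroup α →* E := FreeGroup.lift fun i => σ (PresentedGroup.of i)
  have hy₀ : q.comp y₀ = PresentedGroup.mk _ := by ext i; simp [y₀, hσ, PresentedGroup.of]
  let y : FreeGroup α →* E := FreeGroup.lift fun i => y₀ (w i)
  have hy : q.comp y = PresentedGroup.mk _ := by
    ext i
    simpa [y, mk_generator] using DFunLike.congr_fun hy₀ (w i)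
  have hyx (x : FreeGroup α) : q (y x) = PresentedGroup.mk _ x := DFunLike.congr_fun hy x
  have hyw (i : α) : y (FreeGroup.of i) = y (w i) := by
    have h := MonoidHom.eqOn_commutator_of_mul_inv_mem_center y y₀ (fun x => hqc (by
      rw [MonoidHom.mem_ker, map_mul, map_inv, mul_inv_eq_one, hyx]
      exact (DFunLike.congr_fun hy₀ x).symm)) (hw i)
    rw [h]
    simp [y]
  have hcomm (r : FreeGroup α) (hr : r ∈ R) (i : α) : y ⁅FreeGroup.of i, r⁆ = 1 := by
    have h := MonoidHom.eqOn_commutator_of_mul_inv_mem_center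
      ((MulAut.conj (y r)).toMonoidHom.comp y) y (fun x => hqc (by
        have hc := Subgroup.mem_center_iff.1 (mk_relator_mem_center (w := w) hr)
          (PresentedGroup.mk _ x)
        simp only [MonoidHom.mem_ker, MonoidHom.comp_apply, MulEquiv.coe_toMonoidHom,
          MulAut.conj_apply, map_mul, map_inv, hyx]
        rw [← hc]
        group)) (hw i)
    simp only [MonoidHom.comp_apply, MulEquiv.coe_toMonoidHom, MulAut.conj_apply, ← hyw] at h
    rw [map_commutatorElement, commutatorElement_eq_one_iff_mul_comm]
    exact (mul_inv_eq_iff_eq_mul.1 h).symm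
  refine ⟨PresentedGroup.toGroup (f := fun i => y₀ (w i)) ?_, ?_⟩
  · rintro _ (⟨i, -, r, hr, rfl⟩ | ⟨i, rfl⟩)
    · exact hcomm r hr i
    · change y _ = 1
      rw [map_mul, map_inv, hyw, mul_inv_cancel]
  · intro x
    obtain ⟨x, rfl⟩ := PresentedGroup.mk_surjective _ x
    exact hyx x

theorem h2Trivial (hw : ∀ i, w i ∈ commutator (FreeGroup α)) : H2Trivial (CoverGroup R w) :=
  H2Trivial.of_central_extension_splits fun _ _ q hq hqc => exists_splitting hw q hq hqc

theorem exists_hom {T : Type*} [Group T] (φ : FreeGroup α →* T)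
    (hR : Subgroup.normalClosure R = φ.ker) (hw : ∀ i, φ (w i) = φ (FreeGroup.of i)) :
    ∃ p : CoverGroup R w →* T, (∀ x, p (PresentedGroup.mk _ x) = φ x) ∧
      p.ker ≤ Subgroup.center _ := by
  have hle : Subgroup.normalClosure (coverRelators R w) ≤ φ.ker := by
    refine Subgroup.normalClosure_le_normal ?_
    rintro _ (⟨i, -, r, hr, rfl⟩ | ⟨i, rfl⟩)
    · have hr' : φ r = 1 := hR.le (Subgroup.subset_normalClosure hr)
      simp [MonoidHom.mem_ker, commutatorElement_def, hr']
    · simp [MonoidHom.mem_ker, hw]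
  refine ⟨QuotientGroup.lift _ φ hle, fun x => rfl, fun g hg => ?_⟩
  obtain ⟨x, rfl⟩ := PresentedGroup.mk_surjective _ g
  have hx : x ∈ Subgroup.normalClosure R := hR.ge hg
  exact (Subgroup.normalClosure_le_normal (N := (Subgroup.center (CoverGroup R w)).comap
    (PresentedGroup.mk _)) fun r hr => mk_relator_mem_center hr) hx

theorem exists_groupPres {n : ℕ} {R : Set (FreeGroup (Fin n))} (hR : R.Finite)
    (w : Fin n → FreeGroup (Fin n)) : ∃ r, GroupPres (CoverGroup R w) n r := by
  have hfin : (coverRelators R w).Finite :=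
    (Set.finite_univ.image2 _ hR).union (Set.finite_range _)
  refine ⟨hfin.toFinset.card, PresentedGroup.mk _, hfin.toFinset,
    PresentedGroup.mk_surjective _, rfl, ?_⟩
  rw [hfin.coe_toFinset]
  exact (QuotientGroup.ker_mk' _).symm

theorem subsingleton_abelianization (hw : ∀ i, w i ∈ commutator (FreeGroup α)) :
    Subsingleton (Abelianization (CoverGroup R w)) := by
  rw [Abelianization, commutator_eq_top hw]
  exact QuotientGroup.subsingleton_quotient_top

end CoverGroup

theorem exists_finset_normalClosure_eq_ker {n : ℕ} {T : Type*} [Group T] [Finite T]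
    (φ : FreeGroup (Fin n) →* T) :
    ∃ R : Finset (FreeGroup (Fin n)), Subgroup.normalClosure (R : Set _) = φ.ker := by
  obtain ⟨R, hR⟩ : φ.ker.FG := (Group.fg_iff_subgroup_fg _).1 inferInstance
  refine ⟨R, le_antisymm (Subgroup.normalClosure_le_normal ?_) ?_⟩
  · rw [← hR]
    exact Subgroup.subset_closure
  · rw [← hR]
    exact Subgroup.closure_le_normalClosure

/-- If each value of `x : Fin n → T` in a finite group `T` is a product of commutators in the
subgroup generated by `x`, then this subgroup has a finitely presented superperfect central
extension generated by lifts of these values. -/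
theorem exists_superperfect_cover {T : Type} [Group T] [Finite T] {n : ℕ} (x : Fin n → T)
    (hx : ∀ i, x i ∈ ⁅Subgroup.closure (Set.range x), Subgroup.closure (Set.range x)⁆) :
    ∃ (R : Finset (FreeGroup (Fin n))) (w : Fin n → FreeGroup (Fin n)),
      (∀ i, w i ∈ commutator (FreeGroup (Fin n))) ∧
      ∃ p : CoverGroup (R : Set (FreeGroup (Fin n))) w →* T,
        p.ker ≤ Subgroup.center _ ∧ ∀ i, p (PresentedGroup.of i) = x i := by
  obtain ⟨φ, hφ⟩ : ∃ φ : FreeGroup (Fin n) →* T, φ = FreeGroup.lift x := ⟨_, rfl⟩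
  have hφx (i : Fin n) : φ (FreeGroup.of i) = x i := by rw [hφ, FreeGroup.lift_apply_of]
  have hx' (i : Fin n) : ∃ w ∈ commutator (FreeGroup (Fin n)), φ w = x i := by
    rw [← Subgroup.mem_map, commutator_def, Subgroup.map_commutator, ← MonoidHom.range_eq_map,
      hφ, FreeGroup.range_lift_eq_closure]
    exact hx i
  choose w hw hwx using hx'
  obtain ⟨R, hR⟩ := exists_finset_normalClosure_eq_ker φ
  obtain ⟨p, hp, hpc⟩ := CoverGroup.exists_hom (w := w) φ hR fun i => by rw [hwx, hφx]
  exact ⟨R, w, hw, p, hpc, fun i => (hp (FreeGroup.of i)).trans (hφx i)⟩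

/-! ### Group extensions from cocycles -/

/-- A normalized 2-cocycle of `G` with values in the representation `ρ`. -/
structure IsNormalizedCocycle {G M : Type*} [Group G] [AddCommGroup M]
    (ρ : G →* AddMonoid.End M) (c : G → G → M) : Prop where
  one_left : ∀ g, c 1 g = 0
  one_right : ∀ g, c g 1 = 0
  cocycle : ∀ g h k, c (g * h) k + c g h = ρ g (c h k) + c g (h * k)

theorem IsNormalizedCocycle.zero {G M : Type*} [Group G] [AddCommGroup M]
    (ρ : G →* AddMonoid.End M) : IsNormalizedCocycle ρ (fun _ _ => 0) :=
  ⟨by simp, by simp, by simp⟩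

theorem IsNormalizedCocycle.comp {G H M : Type*} [Group G] [Group H] [AddCommGroup M]
    {ρ : G →* AddMonoid.End M} {c : G → G → M} (hc : IsNormalizedCocycle ρ c) (p : H →* G) :
    IsNormalizedCocycle (ρ.comp p) fun x y => c (p x) (p y) :=
  ⟨by simp [hc.one_left], by simp [hc.one_right], by simp [hc.cocycle]⟩

/-- The extension of `G` by `M` defined by a normalized 2-cocycle. -/
@[ext]
structure CocycleExtension {G M : Type*} [Group G] [AddCommGroup M]
    {ρ : G →* AddMonoid.End M} {c : G → G → M} (hc : IsNormalizedCocycle ρ c) where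
  /-- The fibre coordinate. -/
  fst : M
  /-- The projection to the base. -/
  snd : G

namespace CocycleExtension

variable {G M : Type*} [Group G] [AddCommGroup M] {ρ : G →* AddMonoid.End M} {c : G → G → M}
  {hc : IsNormalizedCocycle ρ c}

instance : Mul (CocycleExtension hc) :=
  ⟨fun x y => ⟨x.fst + ρ x.snd y.fst + c x.snd y.snd, x.snd * y.snd⟩⟩

instance : One (CocycleExtension hc) := ⟨⟨0, 1⟩⟩

instance : Inv (CocycleExtension hc) :=
  ⟨fun x => ⟨-(ρ x.snd⁻¹ x.fst + c x.snd⁻¹ x.snd), x.snd⁻¹⟩⟩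

@[simp]
theorem mul_fst (x y : CocycleExtension hc) :
    (x * y).fst = x.fst + ρ x.snd y.fst + c x.snd y.snd := rfl

@[simp]
theorem mul_snd (x y : CocycleExtension hc) : (x * y).snd = x.snd * y.snd := rfl

@[simp]
theorem one_fst : (1 : CocycleExtension hc).fst = 0 := rfl

@[simp]
theorem one_snd : (1 : CocycleExtension hc).snd = 1 := rfl

@[simp]
theorem inv_fst (x : CocycleExtension hc) :
    x⁻¹.fst = -(ρ x.snd⁻¹ x.fst + c x.snd⁻¹ x.snd) := rfl

@[simp]
theorem inv_snd (x : CocycleExtension hc) : x⁻¹.snd = x.snd⁻¹ := rfl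

instance : Group (CocycleExtension hc) :=
  Group.ofLeftAxioms
    (fun x y z => by
      ext
      · simp only [mul_fst, mul_snd, map_add, map_mul, AddMonoid.End.coe_mul,
          Function.comp_apply]
        have := hc.cocycle x.snd y.snd z.snd
        rw [add_right_comm _ _ (ρ x.snd (ρ y.snd z.fst)), add_assoc _ (c _ _), add_comm (c _ _),
          this]
        abel
      · simp [mul_assoc])
    (fun x => by ext <;> simp [hc.one_left])
    (fun x => by
      ext
      · simp only [mul_fst, inv_fst, inv_snd, one_fst]
        abel
      · simp)

/-- The projection of the extension onto its base. -/
@[simps]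
def proj (hc : IsNormalizedCocycle ρ c) : CocycleExtension hc →* G where
  toFun := snd
  map_one' := rfl
  map_mul' _ _ := rfl

instance [Finite M] [Finite G] : Finite (CocycleExtension hc) :=
  Finite.of_injective (fun x => (x.fst, x.snd)) fun x y h => by
    ext
    · exact (Prod.ext_iff.1 h).1
    · exact (Prod.ext_iff.1 h).2

end CocycleExtension

/-! ### A bound on the deficiency -/

/-- A function `h` whose twisted coboundary is the pull-back of `c` along `π`. -/
def IsTwistedPrimitive {F G M : Type*} [Group F] [Group G] [AddCommGroup M]
    (ρ : G →* AddMonoid.End M) (π : F →* G) (c : G → G → M) (h : F → M) : Prop :=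
  ∀ x y, h (x * y) = h x + ρ (π x) (h y) + c (π x) (π y)

/-- A cocycle pulled back to a free group has a primitive with arbitrary values on generators. -/
theorem exists_isTwistedPrimitive_freeGroup {α G M : Type*} [Group G] [AddCommGroup M]
    {ρ : G →* AddMonoid.End M} {c : G → G → M} (hc : IsNormalizedCocycle ρ c)
    (π : FreeGroup α →* G) (u : α → M) :
    ∃ h : FreeGroup α → M, IsTwistedPrimitive ρ π c h ∧ ∀ i, h (FreeGroup.of i) = u i := by
  let l : FreeGroup α →* CocycleExtension hc :=
    FreeGroup.lift fun i => ⟨u i, π (FreeGroup.of i)⟩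
  have hl : (CocycleExtension.proj hc).comp l = π := by ext i; simp [l]
  have hl' (x : FreeGroup α) : (l x).snd = π x := DFunLike.congr_fun hl x
  exact ⟨fun x => (l x).fst, fun x y => by simp [hl'], fun i => by simp [l]⟩

namespace IsTwistedPrimitive

variable {F G M : Type*} [Group F] [Group G] [AddCommGroup M]
    {ρ : G →* AddMonoid.End M} {π : F →* G} {c : G → G → M} {h : F → M}

theorem map_one (hh : IsTwistedPrimitive ρ π c h) (hc : IsNormalizedCocycle ρ c) : h 1 = 0 := by
  simpa [hc.one_left] using hh 1 1

theorem map_mul_of_mem_ker (hh : IsTwistedPrimitive ρ π c h) (hc : IsNormalizedCocycle ρ c)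
    (x : F) {k : F} (hk : k ∈ π.ker) : h (x * k) = h x + ρ (π x) (h k) := by
  rw [hh, MonoidHom.mem_ker.1 hk, hc.one_right, add_zero]

theorem map_mul_of_mem_ker_left (hh : IsTwistedPrimitive ρ π c h) (hc : IsNormalizedCocycle ρ c)
    {k : F} (hk : k ∈ π.ker) (x : F) : h (k * x) = h k + h x := by
  rw [hh, MonoidHom.mem_ker.1 hk, hc.one_left, add_zero, _root_.map_one]
  rfl

/-- A primitive vanishing on relators vanishes on the whole kernel. -/
theorem eq_zero_of_mem_ker (hh : IsTwistedPrimitive ρ π c h) (hc : IsNormalizedCocycle ρ c)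
    {R : Set F} (hR : Subgroup.normalClosure R = π.ker) (h0 : ∀ r ∈ R, h r = 0)
    {k : F} (hk : k ∈ π.ker) : h k = 0 := by
  let K : Subgroup F :=
    { carrier := {k | k ∈ π.ker ∧ h k = 0}
      one_mem' := ⟨one_mem _, hh.map_one hc⟩
      mul_mem' := fun {a b} ha hb => ⟨mul_mem ha.1 hb.1, by
        rw [hh.map_mul_of_mem_ker_left hc ha.1, ha.2, hb.2, add_zero]⟩
      inv_mem' := fun {a} ha => ⟨inv_mem ha.1, by
        have := hh.map_mul_of_mem_ker_left hc ha.1 a⁻¹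
        rwa [mul_inv_cancel, hh.map_one hc, ha.2, zero_add, eq_comm] at this⟩ }
  have : K.Normal := ⟨fun k hk x => by
    have hx : x * k * x⁻¹ ∈ π.ker := (inferInstance : π.ker.Normal).conj_mem k hk.1 x
    refine ⟨hx, ?_⟩
    have := hh.map_mul_of_mem_ker_left hc hx x
    rwa [inv_mul_cancel_right, hh.map_mul_of_mem_ker hc x hk.1, hk.2, map_zero, add_zero,
      right_eq_add] at this⟩
  have hle : Subgroup.normalClosure R ≤ K := Subgroup.normalClosure_le_normal fun r hr =>
    ⟨hR.le (Subgroup.subset_normalClosure hr), h0 r hr⟩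
  exact (hle (hR.ge hk)).2

/-- A primitive vanishing on the kernel descends to the quotient. -/
theorem exists_descent (hh : IsTwistedPrimitive ρ π c h) (hc : IsNormalizedCocycle ρ c)
    (hπ : Function.Surjective π) (h0 : ∀ k ∈ π.ker, h k = 0) :
    ∃ f : G → M, IsTwistedPrimitive ρ (MonoidHom.id G) c f ∧ ∀ x, f (π x) = h x := by
  have heq (x y : F) (hxy : π x = π y) : h x = h y := by
    have hk : y⁻¹ * x ∈ π.ker := by simp [MonoidHom.mem_ker, hxy]
    have := hh.map_mul_of_mem_ker hc y hk
    rwa [mul_inv_cancel_left, h0 _ hk, map_zero, add_zero] at this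
  choose σ hσ using hπ
  have hf (x : F) : h (σ (π x)) = h x := heq _ _ (hσ _)
  refine ⟨fun g => h (σ g), fun x y => ?_, hf⟩
  simp only [MonoidHom.id_apply]
  rw [heq (σ (x * y)) (σ x * σ y) (by simp [hσ]), hh, hσ, hσ]

/-- A derivation vanishing on generators is zero. -/
theorem eq_zero_of_closure_eq_top {f : G → M}
    (hf : IsTwistedPrimitive ρ (MonoidHom.id G) (fun _ _ => 0) f) {S : Set G}
    (hS : Subgroup.closure S = ⊤) (h0 : ∀ s ∈ S, f s = 0) (g : G) : f g = 0 := by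
  have hc := IsNormalizedCocycle.zero ρ
  have hg : g ∈ Subgroup.closure S := hS ▸ Subgroup.mem_top g
  induction hg using Subgroup.closure_induction with
  | mem x hx => exact h0 x hx
  | one => exact hf.map_one hc
  | mul x y _ _ hx hy => simp [hf x y, hx, hy]
  | inv x _ hx =>
    have := hf x⁻¹ x
    rwa [inv_mul_cancel, hf.map_one hc, hx, map_zero, add_zero, add_zero, eq_comm] at this

end IsTwistedPrimitive

/-- If `G` has a presentation with `g` generators and `r` relators and `A` embeds in
`H²(G; M)`, then `|M|^g |A| ≤ |M|^r |Der(G, M)|`, and `|Der(G, M)| ≤ |M|^n` if `G` is generated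
by `n` elements. -/
theorem GroupPres.card_pow_mul_card_le {G : Type} [Group G] {g r n : ℕ} (hG : GroupPres G g r)
    {M A : Type*} [AddCommGroup M] [Finite M] [AddCommGroup A]
    (ρ : G →* AddMonoid.End M) (c : A →+ (G → G → M))
    (hc : ∀ a, IsNormalizedCocycle ρ (c a))
    (hinj : ∀ a f, IsTwistedPrimitive ρ (MonoidHom.id G) (c a) f → a = 0)
    (y : Fin n → G) (hy : Subgroup.closure (Set.range y) = ⊤) :
    Nat.card M ^ g * Nat.card A ≤ Nat.card M ^ r * Nat.card M ^ n := by
  obtain ⟨π, R, hπ, rfl, hR⟩ := hG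
  choose t ht using fun i => hπ (y i)
  let X : AddSubgroup ((FreeGroup (Fin g) → M) × A) :=
    { carrier := {p | IsTwistedPrimitive ρ π (c p.2) p.1}
      zero_mem' := fun x z => by simp
      add_mem' := fun {p q} hp hq x z => by
        simp only [Prod.fst_add, Prod.snd_add, Pi.add_apply, map_add, hp x z, hq x z]
        abel
      neg_mem' := fun {p} hp x z => by
        simp only [Prod.fst_neg, Prod.snd_neg, Pi.neg_apply, map_neg, hp x z]
        abel }
  let Φ : X →+ (R → M) × (Fin n → M) :=
    { toFun := fun p => (fun k => p.1.1 k, fun i => p.1.1 (t i))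
      map_zero' := rfl
      map_add' := fun _ _ => rfl }
  have hΦ : Function.Injective Φ := by
    rw [injective_iff_map_eq_zero]
    rintro ⟨⟨h, a⟩, hh⟩ h0
    replace hh : IsTwistedPrimitive ρ π (c a) h := hh
    have h1 : ∀ k ∈ π.ker, h k = 0 := fun k hk => hh.eq_zero_of_mem_ker (hc a) hR
      (fun k hk => congrFun (Prod.ext_iff.1 h0).1 ⟨k, hk⟩) hk
    obtain ⟨f, hf, hfh⟩ := hh.exists_descent (hc a) hπ h1
    obtain rfl := hinj a f hf
    rw [map_zero] at hf
    have hf0 := hf.eq_zero_of_closure_eq_top hy (by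
      rintro _ ⟨i, rfl⟩
      rw [← ht, hfh]
      exact congrFun (Prod.ext_iff.1 h0).2 i)
    have : h = 0 := funext fun x => (hfh x).symm.trans (hf0 _)
    subst this
    rfl
  have hfin : Finite X := Finite.of_injective Φ hΦ
  have h1 := Nat.card_le_card_of_injective Φ hΦ
  let Ψ : X → (Fin g → M) × A := fun p => (fun i => p.1.1 (FreeGroup.of i), p.1.2)
  have hΨ : Function.Surjective Ψ := by
    rintro ⟨u, a⟩
    obtain ⟨h, hh, hu⟩ := exists_isTwistedPrimitive_freeGroup (hc a) π u
    exact ⟨⟨(h, a), hh⟩, Prod.ext (funext hu) rfl⟩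
  have h2 := Nat.card_le_card_of_surjective Ψ hΨ
  simpa [Nat.card_prod, Nat.card_fun] using h2.trans h1

/-! ### Permutational wreath products with the alternating group -/

/-- The alternating group of degree five acting on `K`-valued functions on five points. -/
def altRep (K : Type*) [AddCommGroup K] :
    alternatingGroup (Fin 5) →* AddMonoid.End (Fin 5 → K) where
  toFun σ :=
    { toFun := fun v x => v ((σ : Equiv.Perm (Fin 5))⁻¹ x)
      map_zero' := rfl
      map_add' := fun _ _ => rfl }
  map_one' := rfl
  map_mul' _ _ := rfl

@[simp]
theorem altRep_apply {K : Type*} [AddCommGroup K] (σ : alternatingGroup (Fin 5)) (v : Fin 5 → K)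
    (x : Fin 5) : altRep K σ v x = v ((σ : Equiv.Perm (Fin 5))⁻¹ x) := rfl

/-- The wreath product of `K` with the alternating group of degree five. -/
abbrev AltWreath (K : Type*) [AddCommGroup K] :=
  CocycleExtension (IsNormalizedCocycle.zero (altRep K))

namespace AltWreath

variable {K L : Type*} [AddCommGroup K] [AddCommGroup L]

/-- The inclusion of the alternating group. -/
def top (K : Type*) [AddCommGroup K] : alternatingGroup (Fin 5) →* AltWreath K where
  toFun σ := ⟨0, σ⟩
  map_one' := rfl
  map_mul' σ τ := by ext <;> simp

/-- The base element with value `κ` at `a` and `-κ` at `b`. -/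
def base (κ : K) (a b : Fin 5) : AltWreath K := ⟨Pi.single a κ - Pi.single b κ, 1⟩

theorem altRep_single (σ : alternatingGroup (Fin 5)) (a : Fin 5) (κ : K) :
    altRep K σ (Pi.single a κ) = Pi.single ((σ : Equiv.Perm (Fin 5)) a) κ := by
  ext x
  simp only [altRep_apply, Pi.single_apply, Equiv.Perm.inv_eq_iff_eq]

theorem base_self (κ : K) (a : Fin 5) : base κ a a = 1 := by
  ext <;> simp [base]

theorem commutator_top_base (σ : alternatingGroup (Fin 5)) (κ : K) {a b c : Fin 5}
    (hb : (σ : Equiv.Perm (Fin 5)) b = a) (hc : (σ : Equiv.Perm (Fin 5)) c = c) :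
    ⁅top K σ, base κ b c⁆ = base κ a b := by
  rw [commutatorElement_def, mul_inv_eq_iff_eq_mul, mul_inv_eq_iff_eq_mul]
  ext1
  · simp [top, base, altRep_single, hb, hc]
  · simp [top, base]

theorem exists_alternating_map (a b : Fin 5) (hab : a ≠ b) :
    ∃ (σ : alternatingGroup (Fin 5)) (c : Fin 5),
      (σ : Equiv.Perm (Fin 5)) b = a ∧ (σ : Equiv.Perm (Fin 5)) c = c := by
  have h : ∀ a b : Fin 5, a ≠ b → ∃ c d e : Fin 5, c ≠ a ∧ c ≠ b ∧ d ≠ a ∧ d ≠ b ∧ e ≠ a ∧ e ≠ b ∧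
    c ≠ d ∧ c ≠ e ∧ d ≠ e := by decide
  obtain ⟨c, d, e, hca, hcb, hda, hdb, hea, heb, hcd, hce, hde⟩ := h a b hab
  refine ⟨⟨Equiv.swap a b * Equiv.swap d e, ?_⟩, c, ?_, ?_⟩
  · simp [Equiv.Perm.mem_alternatingGroup, hab, hde]
  · simp [Equiv.swap_apply_of_ne_of_ne hdb.symm heb.symm]
  · simp [Equiv.swap_apply_of_ne_of_ne hcd hce, Equiv.swap_apply_of_ne_of_ne hca hcb]

/-- A subgroup generated by the top group and some elementary base elements is perfect. -/
theorem mem_commutator_closure {S : Set (AltWreath K)} {κs : Set K}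
    (htop : ∀ σ, top K σ ∈ S) (hbase : ∀ κ ∈ κs, ∀ a b, base κ a b ∈ S)
    {x : AltWreath K} (hx : (∃ σ, top K σ = x) ∨ ∃ κ ∈ κs, ∃ a b, base κ a b = x) :
    x ∈ ⁅Subgroup.closure S, Subgroup.closure S⁆ := by
  obtain ⟨σ, rfl⟩ | ⟨κ, hκ, a, b, rfl⟩ := hx
  · have hσ : σ ∈ commutator (alternatingGroup (Fin 5)) := by
      rw [commutator_alternatingGroup_eq_top (by simp)]
      exact Subgroup.mem_top σ
    have h := Subgroup.mem_map_of_mem (top K) hσ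
    rw [commutator_def, Subgroup.map_commutator] at h
    have hle : (⊤ : Subgroup (alternatingGroup (Fin 5))).map (top K) ≤ Subgroup.closure S := by
      rintro _ ⟨τ, -, rfl⟩
      exact Subgroup.subset_closure (htop τ)
    exact Subgroup.commutator_mono hle hle h
  · obtain rfl | hab := eq_or_ne a b
    · rw [base_self]
      exact one_mem _
    obtain ⟨σ, c, hb, hc⟩ := exists_alternating_map a b hab
    rw [← commutator_top_base σ κ hb hc]
    exact Subgroup.commutator_mem_commutator (Subgroup.subset_closure (htop σ))
      (Subgroup.subset_closure (hbase κ hκ b c))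

/-- The action of the wreath product on `L`-valued functions through the top group. -/
def rep (K L : Type*) [AddCommGroup K] [AddCommGroup L] :
    AltWreath K →* AddMonoid.End (Fin 5 → L) :=
  (altRep L).comp (CocycleExtension.proj _)

@[simp]
theorem rep_apply (t : AltWreath K) (m : Fin 5 → L) (x : Fin 5) :
    rep K L t m x = m ((t.snd : Equiv.Perm (Fin 5))⁻¹ x) := rfl

/-- The cup square of the tautological derivation with respect to a bilinear map. -/
def cup (B : K →+ K →+ L) (t t' : AltWreath K) (x : Fin 5) : L :=
  B (t.fst x) (altRep K t.snd t'.fst x)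

theorem isNormalizedCocycle_cup (B : K →+ K →+ L) : IsNormalizedCocycle (rep K L) (cup B) where
  one_left g := by ext x; simp [cup]
  one_right g := by ext x; simp [cup]
  cocycle g h k := by
    ext x
    simp only [cup, Pi.add_apply, CocycleExtension.mul_fst, CocycleExtension.mul_snd, map_add,
      AddMonoidHom.add_apply, altRep_apply, rep_apply, Subgroup.coe_mul, mul_inv_rev,
      Equiv.Perm.mul_apply, Pi.zero_apply, add_zero]
    abel

/-- If the pull-back of `cup B` to a central extension is a coboundary, then `B κ κ'` vanishes
whenever `B κ' κ` does. -/
theorem apply_eq_zero_of_isTwistedPrimitive {G : Type*} [Group G] (p : G →* AltWreath K)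
    (hp : p.ker ≤ Subgroup.center G) (B : K →+ K →+ L) {f : G → Fin 5 → L}
    (hf : IsTwistedPrimitive ((rep K L).comp p) (MonoidHom.id G)
      (fun x y => cup B (p x) (p y)) f)
    (htop : ∀ σ, ∃ s, p s = top K σ) {κ κ' : K} {u w : G} (hu : p u = base κ 0 1)
    (hw : p w = base κ' 0 2) (hB : B κ' κ = 0) : B κ κ' = 0 := by
  have hf' (x y : G) (i : Fin 5) : f (x * y) i = f x i +
      f y (((p x).snd : Equiv.Perm (Fin 5))⁻¹ i) + cup B (p x) (p y) i := congrFun (hf x y) i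
  have hcomm : p (u * w) = p (w * u) := by
    rw [map_mul, map_mul, hu, hw]
    ext1
    · simp [base, add_comm]
    · simp [base]
  obtain ⟨z, hz⟩ : ∃ z, z * (w * u) = u * w := ⟨u * w * (w * u)⁻¹, by group⟩
  have hzp : p z = 1 := by rwa [← hz, map_mul, mul_eq_right] at hcomm
  have hfz (i : Fin 5) : f (u * w) i = f z i + f (w * u) i := by
    rw [← hz, hf', hzp, (isNormalizedCocycle_cup B).one_left]
    simp
  have hval : f z 0 = B κ κ' := by
    have h0 := hfz 0
    rw [hf' u w, hf' w u] at h0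
    simp [hu, hw, base, cup, hB] at h0
    rw [add_comm (f w 0), add_comm (f z 0)] at h0
    exact (add_left_cancel h0).symm
  have hval' : f z 1 = 0 := by
    have h0 := hfz 1
    rw [hf' u w, hf' w u] at h0
    simp [hu, hw, base, cup] at h0
    rwa [add_comm (f w 1), right_eq_add] at h0
  obtain ⟨σ, -, hσ, -⟩ := exists_alternating_map 0 1 (by decide)
  obtain ⟨s, hs⟩ := htop σ
  have hσ0 : (σ : Equiv.Perm (Fin 5))⁻¹ 0 = 1 := by rw [Equiv.Perm.inv_eq_iff_eq, hσ]
  have hsz : f (s * z) 0 = f (z * s) 0 := by rw [Subgroup.mem_center_iff.1 (hp hzp) s]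
  have hs' : (p s).snd = σ := by rw [hs]; rfl
  rw [hf', hf', hzp, (isNormalizedCocycle_cup B).one_left,
    (isNormalizedCocycle_cup B).one_right, hs', hσ0, hval', hval] at hsz
  simpa using hsz

end AltWreath

/-! ### Groups of large negative deficiency -/

open scoped Matrix

/-- The bilinear form on pairs of vectors pairing first with second components via a matrix. -/
def offDiagonalForm {k : ℕ} (a : Matrix (Fin k) (Fin k) (ZMod 2)) :
    (Fin k → ZMod 2) × (Fin k → ZMod 2) →+ (Fin k → ZMod 2) × (Fin k → ZMod 2) →+ ZMod 2 :=
  AddMonoidHom.mk' (fun l => AddMonoidHom.mk' (fun m => l.1 ⬝ᵥ a *ᵥ m.2)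
    fun m m' => by simp [Matrix.mulVec_add, dotProduct_add])
    fun l l' => by ext; simp [add_dotProduct]

theorem offDiagonalForm_apply {k : ℕ} (a : Matrix (Fin k) (Fin k) (ZMod 2))
    (l m : (Fin k → ZMod 2) × (Fin k → ZMod 2)) : offDiagonalForm a l m = l.1 ⬝ᵥ a *ᵥ m.2 := rfl

/-- Unit vectors in the two summands. -/
def unitVector {k : ℕ} : Fin k ⊕ Fin k → (Fin k → ZMod 2) × (Fin k → ZMod 2) :=
  Sum.elim (fun i => (Pi.single i 1, 0)) fun j => (0, Pi.single j 1)

/-- Generators of a perfect subgroup of the wreath product. -/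
def wreathGenerator {k : ℕ} : alternatingGroup (Fin 5) ⊕ ((Fin k ⊕ Fin k) × Fin 5 × Fin 5) →
    AltWreath ((Fin k → ZMod 2) × (Fin k → ZMod 2)) :=
  Sum.elim (AltWreath.top _) fun q => AltWreath.base (unitVector q.1) q.2.1 q.2.2

theorem wreathGenerator_mem_commutator {k : ℕ}
    (i : alternatingGroup (Fin 5) ⊕ ((Fin k ⊕ Fin k) × Fin 5 × Fin 5)) :
    wreathGenerator i ∈ ⁅Subgroup.closure (Set.range (wreathGenerator (k := k))),
      Subgroup.closure (Set.range (wreathGenerator (k := k)))⁆ := by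
  refine AltWreath.mem_commutator_closure (κs := Set.range unitVector)
    ?_ ?_ ?_
  · exact fun σ => ⟨Sum.inl σ, rfl⟩
  · rintro _ ⟨j, rfl⟩ a b
    exact ⟨Sum.inr (j, a, b), rfl⟩
  · rcases i with σ | ⟨j, a, b⟩
    · exact Or.inl ⟨σ, rfl⟩
    · exact Or.inr ⟨_, ⟨j, rfl⟩, a, b, rfl⟩

theorem card_wreathGenerator_index (k : ℕ) : Fintype.card
    (alternatingGroup (Fin 5) ⊕ ((Fin k ⊕ Fin k) × Fin 5 × Fin 5)) = 60 + 50 * k := by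
  have h := two_mul_card_alternatingGroup (α := Fin 5)
  rw [Fintype.card_perm, Fintype.card_fin] at h
  simp only [Fintype.card_sum, Fintype.card_prod, Fintype.card_fin]
  simp only [Nat.factorial] at h
  omega

/-- The deficiency bound for central extensions of the wreath products. -/
theorem GroupPres.five_mul_add_sq_le {G : Type} [Group G] {g r n k : ℕ} (hG : GroupPres G g r)
    (p : G →* AltWreath ((Fin k → ZMod 2) × (Fin k → ZMod 2)))
    (hp : p.ker ≤ Subgroup.center G) (y : Fin n → G)
    (hy : Subgroup.closure (Set.range y) = ⊤)
    (hpy : ∀ i, ∃ s, p s = wreathGenerator (k := k) i) : 5 * g + k ^ 2 ≤ 5 * r + 5 * n := by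
  let c : Matrix (Fin k) (Fin k) (ZMod 2) →+ (G → G → Fin 5 → ZMod 2) :=
    AddMonoidHom.mk' (fun a x y => AltWreath.cup (offDiagonalForm a) (p x) (p y)) fun a b => by
      ext x y i
      simp [AltWreath.cup, offDiagonalForm_apply, Matrix.add_mulVec, dotProduct_add]
  have h := hG.card_pow_mul_card_le ((AltWreath.rep _ (ZMod 2)).comp p) c
    (fun a => (AltWreath.isNormalizedCocycle_cup (offDiagonalForm a)).comp p)
    (fun a f hf => by
      ext i j
      obtain ⟨u, hu⟩ := hpy (Sum.inr (Sum.inl i, 0, 1))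
      obtain ⟨w, hw⟩ := hpy (Sum.inr (Sum.inr j, 0, 2))
      have := AltWreath.apply_eq_zero_of_isTwistedPrimitive p hp (offDiagonalForm a) hf
        (fun σ => hpy (Sum.inl σ)) hu hw (by simp [offDiagonalForm_apply, unitVector])
      simpa [offDiagonalForm_apply, unitVector] using this) y hy
  have hM : Nat.card (Fin 5 → ZMod 2) = 2 ^ 5 := by simp
  have hA : Nat.card (Matrix (Fin k) (Fin k) (ZMod 2)) = 2 ^ k ^ 2 := by
    simp [Matrix, ← pow_mul, sq]
  rw [hM, hA, ← pow_mul, ← pow_mul, ← pow_mul, ← pow_add, ← pow_add] at h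
  exact (Nat.pow_le_pow_iff_right (by norm_num)).1 h

/-- Some universal central extension has deficiency less than `-N`. -/
theorem exists_coverGroup_of_large_negative_deficiency (N : ℕ) :
    ∃ (n : ℕ) (R : Finset (FreeGroup (Fin n))) (w : Fin n → FreeGroup (Fin n)),
      (∀ i, w i ∈ commutator (FreeGroup (Fin n))) ∧
      ∀ g r : ℕ, GroupPres (CoverGroup (R : Set (FreeGroup (Fin n))) w) g r →
        (g : ℤ) - (r : ℤ) < -(N : ℤ) := by
  obtain ⟨k, hk⟩ : ∃ k, k = 551 + 5 * N := ⟨_, rfl⟩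
  have e := Fintype.equivFin (alternatingGroup (Fin 5) ⊕ ((Fin k ⊕ Fin k) × Fin 5 × Fin 5))
  have hrange : Set.range (wreathGenerator ∘ e.symm) = Set.range (wreathGenerator (k := k)) :=
    e.symm.surjective.range_comp _
  obtain ⟨R, w, hw, p, hp, hpx⟩ := exists_superperfect_cover (wreathGenerator ∘ e.symm)
    fun i => by
      rw [hrange]
      exact wreathGenerator_mem_commutator _
  refine ⟨_, R, w, hw, fun g r hG => ?_⟩
  have h := hG.five_mul_add_sq_le p hp PresentedGroup.of (PresentedGroup.closure_range_of _)
    fun i => ⟨PresentedGroup.of (e i), by simp [hpx]⟩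
  rw [card_wreathGenerator_index] at h
  have hsq : k ^ 2 = 250 * k + (301 + 5 * N) * k := by rw [sq]; nth_rw 1 [hk]; ring
  have hle : 301 + 5 * N ≤ (301 + 5 * N) * k := Nat.le_mul_of_pos_right _ (by omega)
  omega

/-- Deficiency bounds for a universal central extension are deficiency bounds for a superperfect
group. -/
theorem CoverGroup.exists_superperfect_group {N n : ℕ} {R : Finset (FreeGroup (Fin n))}
    {w : Fin n → FreeGroup (Fin n)} (hw : ∀ i, w i ∈ commutator (FreeGroup (Fin n)))
    (hdef : ∀ g r : ℕ, GroupPres (CoverGroup (R : Set (FreeGroup (Fin n))) w) g r →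
      (g : ℤ) - (r : ℤ) < -(N : ℤ)) :
    ∃ (G : Type) (_ : Group G), (∃ g r, GroupPres G g r) ∧ Subsingleton (Abelianization G) ∧
      H2Trivial G ∧ ∀ g r : ℕ, GroupPres G g r → (g : ℤ) - (r : ℤ) < -(N : ℤ) :=
  ⟨CoverGroup (R : Set (FreeGroup (Fin n))) w, inferInstance,
    ⟨n, CoverGroup.exists_groupPres R.finite_toSet w⟩,
    CoverGroup.subsingleton_abelianization hw, CoverGroup.h2Trivial hw, hdef⟩

/-- For every `N` there is a finitely presented perfect group `G` with
`H₂(G; ℤ) = 0` such that every finite presentation of `G` with `g` generators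
and `r` relations has `g − r < −N`: there are finitely presented perfect groups
with `H₂ = 0` of arbitrarily large negative deficiency. -/
theorem exists_perfect_group_of_large_negative_deficiency (N : ℕ) :
    ∃ (G : Type) (inst : Group G),
      (∃ g r : ℕ, @GroupPres G inst g r) ∧
      Subsingleton (@Abelianization G inst) ∧
      @H2Trivial G inst ∧
      ∀ g r : ℕ, @GroupPres G inst g r → (g : ℤ) - (r : ℤ) < -(N : ℤ) := by
  obtain ⟨n, R, w, hw, hdef⟩ := exists_coverGroup_of_large_negative_deficiency N
  exact CoverGroup.exists_superperfect_group hw hdef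
end
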